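/- Let Q = (J,σ,ξ) be a Q-datum and 𝐢 a reduced word of w₀ adapted to Q. If 𝐦, 𝐧 ∈ ℤ_{≥0}^{R⁺} satisfy Ω_Q(𝐦) − Ω_Q(𝐧) ∈ 𝒬_ℤ, then Σ_{α∈R⁺} 𝐦(α)·α = Σ_{α∈R⁺} 𝐧(α)·α in the root lattice Q_𝔰. (In particular, if two nonnegative Kostant-type partitions have ℓ-weights Ω_Q(𝐦), Ω_Q(𝐧) differing by an element of the ℓ-root lattice, then they are partitions of the same element β.) -/

import Mathlib

open scoped BigOperators Classical

namespace QDatumPaper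

structure CartanADE (J : Type) [Fintype J] [DecidableEq J] where
  a : J → J → ℤ
  symm : ∀ ι j : J, a ι j = a j ι
  diag : ∀ ι : J, a ι ι = 2
  offDiag : ∀ ι j : J, ι ≠ j → a ι j = 0 ∨ a ι j = -1
  posDef : ∀ v : J → ℚ, v ≠ 0 → 0 < ∑ ι : J, ∑ j : J, v ι * (a ι j : ℚ) * v j
  indec : ∀ s : Set J, s.Nonempty →
    (∀ ι ∈ s, ∀ j : J, a ι j = -1 → j ∈ s) → s = Set.univ

variable {J : Type} [Fintype J] [DecidableEq J]

/-- `j` lies in the `σ`-orbit of `ι`. -/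
def SameOrbit (σ : Equiv.Perm J) (ι j : J) : Prop := ∃ k : ℕ, (σ ^ k) ι = j

/-- The size `𝗌_{\barι}` of the `σ`-orbit of `ι`. -/
noncomputable def orbitSize (σ : Equiv.Perm J) (ι : J) : ℕ :=
  ((Finset.range (orderOf σ)).image fun k => (σ ^ k) ι).card

/-- A diagram automorphism of the Cartan matrix `C`: no two distinct vertices in a common
orbit are adjacent. -/
structure DiagAut (C : CartanADE J) where
  σ : Equiv.Perm J
  compat : ∀ ι j : J, C.a (σ ι) (σ j) = C.a ι j
  noAdj : ∀ (ι : J) (k : ℕ), (σ ^ k) ι ≠ ι → C.a ι ((σ ^ k) ι) ≠ -1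

/-- Height function on `(J, σ)`. -/
def IsHeightFunction (C : CartanADE J) (D : DiagAut C) (ξ : J → ℤ) : Prop :=
  (∀ ι j : J, C.a ι j = -1 → orbitSize D.σ ι = orbitSize D.σ j →
      |ξ ι - ξ j| = (orbitSize D.σ ι : ℤ)) ∧
  (∀ ι j : J, C.a ι j = -1 → orbitSize D.σ ι < orbitSize D.σ j →
      ∃! j0 : J, SameOrbit D.σ j j0 ∧ |ξ ι - ξ j0| = 1 ∧
        ∀ k : ℕ, k < orderOf D.σ → ξ ((D.σ ^ k) j0) = ξ j0 - 2 * (k : ℤ))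

/-- Symmetric bilinear form on the root lattice `ℤ^J`. -/
def pairing (C : CartanADE J) (v w : J → ℤ) : ℤ := ∑ ι : J, ∑ j : J, v ι * C.a ι j * w j

/-- Positive roots. -/
def posRoots (C : CartanADE J) : Set (J → ℤ) :=
  {v | (∀ ι : J, 0 ≤ v ι) ∧ v ≠ 0 ∧ pairing C v v = 2}

def simpleRoot (ι : J) : J → ℤ := fun j => if j = ι then 1 else 0

/-- Simple reflection `s_ι` on the root lattice. -/
def reflS (C : CartanADE J) (ι : J) (v : J → ℤ) : J → ℤ :=
  fun j => v j - (∑ κ : J, v κ * C.a κ ι) * simpleRoot ι j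

/-- `applyRefls C [ι₁, …, ι_m] v = s_{ι₁}(s_{ι₂}(⋯ s_{ι_m}(v)⋯))`. -/
def applyRefls (C : CartanADE J) (w : List J) (v : J → ℤ) : J → ℤ :=
  w.foldr (reflS C) v

/-- `β_k = s_{ι₁} ⋯ s_{ι_{k-1}} (α_{ι_k})`. -/
def betaOf (C : CartanADE J) {L : ℕ} (ii : Fin L → J) (k : Fin L) : J → ℤ :=
  applyRefls C ((List.ofFn ii).take k.1) (simpleRoot (ii k))

/-- `ii` is a reduced word of the longest element. -/
def IsReducedWord (C : CartanADE J) {L : ℕ} (ii : Fin L → J) : Prop :=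
  L = (posRoots C).ncard ∧ Function.Injective (betaOf C ii) ∧
    ∀ k : Fin L, betaOf C ii k ∈ posRoots C

def pairingQ (C : CartanADE J) (v w : J → ℚ) : ℚ :=
  ∑ ι : J, ∑ j : J, v ι * (C.a ι j : ℚ) * w j

def reflQ (C : CartanADE J) (ι : J) (v : J → ℚ) : J → ℚ :=
  fun j => v j - (∑ κ : J, v κ * (C.a κ ι : ℚ)) * (if j = ι then 1 else 0)

def applyReflsQ (C : CartanADE J) (w : List J) (v : J → ℚ) : J → ℚ :=
  w.foldr (reflQ C) v

/-- `Λ` is a system of fundamental weights: `(Λ_ι, α_j) = δ_{ιj}`. -/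
def IsFundWeights (C : CartanADE J) (Λ : J → J → ℚ) : Prop :=
  ∀ ι j : J, pairingQ C (Λ ι) (fun κ => (simpleRoot j κ : ℚ)) = if ι = j then 1 else 0

/-- `ν_k = -(s_{ι₁} ⋯ s_{ι_k})(Λ_{ι_k})`. -/
def nuOf (C : CartanADE J) {L : ℕ} (ii : Fin L → J) (Λ : J → J → ℚ) (k : Fin L) : J → ℚ :=
  - applyReflsQ C ((List.ofFn ii).take (k.1 + 1)) (Λ (ii k))

def betaQ (C : CartanADE J) {L : ℕ} (ii : Fin L → J) (k : Fin L) : J → ℚ :=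
  fun j => (betaOf C ii k j : ℚ)

/-- The pairing `(ν_k, β_t)`. -/
def nuBetaPair (C : CartanADE J) {L : ℕ} (ii : Fin L → J) (Λ : J → J → ℚ) (k t : Fin L) : ℚ :=
  pairingQ C (nuOf C ii Λ k) (betaQ C ii t)

/-- `m` is a Kostant partition of `β`. -/
def IsKP (C : CartanADE J) (β : J → ℤ) (m : (J → ℤ) → ℤ) : Prop :=
  (∀ v : J → ℤ, v ∉ posRoots C → m v = 0) ∧ (∀ v ∈ posRoots C, 0 ≤ m v) ∧
    ∑ᶠ v ∈ posRoots C, m v • v = β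

/-- `ρ^ii(m)_r = Σ_{t ≤ r} m(β_t)(ν_r, β_t)`. -/
def rhoOf (C : CartanADE J) {L : ℕ} (ii : Fin L → J) (Λ : J → J → ℚ)
    (m : (J → ℤ) → ℤ) (r : Fin L) : ℚ :=
  ∑ t ∈ Finset.univ.filter (fun t : Fin L => t ≤ r),
    (m (betaOf C ii t) : ℚ) * nuBetaPair C ii Λ r t

/-- The partial order `≼_ii` on Kostant partitions. -/
def kpLE (C : CartanADE J) {L : ℕ} (ii : Fin L → J) (Λ : J → J → ℚ)
    (m n : (J → ℤ) → ℤ) : Prop :=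
  ∀ r : Fin L, rhoOf C ii Λ m r ≤ rhoOf C ii Λ n r

/-- The height function obtained from `ξ` by applying sources `w = [ι₁, …, ι_k]`. -/
noncomputable def heightAfter (σ : Equiv.Perm J) (ξ : J → ℤ) (w : List J) : J → ℤ :=
  w.foldl (fun η ι => fun j => η j - if j = ι then 2 * (orbitSize σ ι : ℤ) else 0) ξ

def IsSource (C : CartanADE J) (ξ : J → ℤ) (ι : J) : Prop :=
  ∀ j : J, C.a ι j = -1 → ξ j < ξ ι

/-- `ii` is adapted to the Q-datum `(J, σ, ξ)`. -/
def IsAdapted (C : CartanADE J) (D : DiagAut C) (ξ : J → ℤ) {L : ℕ} (ii : Fin L → J) : Prop :=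
  ∀ k : Fin L, IsSource C (heightAfter D.σ ξ ((List.ofFn ii).take k.1)) (ii k)

/-- `(s_{ι_{k-1}} ⋯ s_{ι_1} ξ)_{ι_k}`, the second component of `Ω̃_Q(β_k)`. -/
noncomputable def heightAt (σ : Equiv.Perm J) (ξ : J → ℤ) {L : ℕ} (ii : Fin L → J) (k : Fin L) : ℤ :=
  heightAfter σ ξ ((List.ofFn ii).take k.1) (ii k)

/-- `x ∈ Im Ω̃_Q`. -/
def InImOmega (σ : Equiv.Perm J) (ξ : J → ℤ) {L : ℕ} (ii : Fin L → J) (x : J × ℤ) : Prop :=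
  ∃ k : Fin L, ii k = x.1 ∧ heightAt σ ξ ii k = x.2

/-- A single commutation move. -/
def CommStep (C : CartanADE J) {L : ℕ} (ii jj : Fin L → J) : Prop :=
  ∃ (k : ℕ) (h1 : k < L) (h2 : k + 1 < L),
    C.a (ii ⟨k, h1⟩) (ii ⟨k + 1, h2⟩) = 0 ∧
    jj = ii ∘ Equiv.swap (⟨k, h1⟩ : Fin L) ⟨k + 1, h2⟩

/-- Commutation equivalence of words. -/
def CommEquiv (C : CartanADE J) {L : ℕ} (ii jj : Fin L → J) : Prop :=
  Relation.ReflTransGen (CommStep C) ii jj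

/-- The orbits of `ι` and `j` are adjacent (`\barι ∼ \barj` in `I₀`). -/
def adjOrbit (C : CartanADE J) (σ : Equiv.Perm J) (ι j : J) : Prop :=
  ∃ ι' j' : J, SameOrbit σ ι ι' ∧ SameOrbit σ j j' ∧ C.a ι' j' = -1

/-- `c ι j` is the Cartan matrix `c_{\barι \barj}` of the folded algebra `𝔤₀`. -/
noncomputable def IsFoldedCartan (C : CartanADE J) (σ : Equiv.Perm J) (c : J → J → ℤ) : Prop :=
  ∀ ι j : J, (c ι j : ℚ) =
    if SameOrbit σ ι j then 2
    else if adjOrbit C σ ι j then -(max 1 ((orbitSize σ j : ℚ) / (orbitSize σ ι : ℚ)))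
    else 0

/-- The basis element `ϖ_{\barι, p}` of `𝒫_ℤ`, realized as a function on `J × ℤ`
(the indicator of `orbit(ι) × {p}`). -/
noncomputable def varpiF (σ : Equiv.Perm J) (ι : J) (p : ℤ) : (J × ℤ) → ℤ :=
  fun y => if SameOrbit σ ι y.1 ∧ y.2 = p then 1 else 0

/-- The ℓ-root `α_{\barι, p}`. -/
noncomputable def lrootF (σ : Equiv.Perm J) (c : J → J → ℤ) (ι : J) (p : ℤ) : (J × ℤ) → ℤ :=
  fun y => varpiF σ ι (p + (orbitSize σ ι : ℤ)) y + varpiF σ ι (p - (orbitSize σ ι : ℤ)) y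
    - (if (¬ SameOrbit σ ι y.1) ∧
          ∃ k : ℤ, 1 ≤ k ∧ k ≤ -(c y.1 ι) ∧ y.2 = p - c y.1 ι + 1 - 2 * k
       then 1 else 0)

/-- `(\barι, p + 𝗌_{\barι}) ∈ Î₀`, i.e. the index `(\barι,p)` gives a valid ℓ-root. -/
def ValidLRootIdx (σ : Equiv.Perm J) (ξ : J → ℤ) (ι : J) (p : ℤ) : Prop :=
  (2 : ℤ) ∣ (p + (orbitSize σ ι : ℤ) - ξ ι)

/-- The set of all ℓ-roots (generating `𝒬_ℤ`). -/
noncomputable def lrootSet (σ : Equiv.Perm J) (ξ : J → ℤ) (c : J → J → ℤ) :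
    Set ((J × ℤ) → ℤ) :=
  {x | ∃ (ι : J) (p : ℤ), ValidLRootIdx σ ξ ι p ∧ x = lrootF σ c ι p}

/-- The ℤ-linear map `Ω_Q : ℤ^{R⁺} → 𝒫_ℤ`. -/
noncomputable def OmegaQmap (C : CartanADE J) (σ : Equiv.Perm J) (ξ : J → ℤ) {L : ℕ}
    (ii : Fin L → J) (m : (J → ℤ) → ℤ) : (J × ℤ) → ℤ :=
  ∑ k : Fin L, m (betaOf C ii k) • varpiF σ (ii k) (heightAt σ ξ ii k)


/-! ### Two-sided dynamics -/

lemma exists_two_sided {A : Type} (P : ℤ → A → A) (hP : ∀ t x, P t (P t x) = x) (T : ℤ) (x0 : A) :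
    ∃ X : ℤ → A, X T = x0 ∧ ∀ t, X (t - 1) = P t (X t) := by
  let up : ℕ → A := fun n => Nat.rec x0 (fun n x => P (T + n + 1) x) n
  let dn : ℕ → A := fun n => Nat.rec x0 (fun n x => P (T - n) x) n
  have hup : ∀ n, up (n + 1) = P (T + n + 1) (up n) := fun n => rfl
  have hdn : ∀ n, dn (n + 1) = P (T - n) (dn n) := fun n => rfl
  refine ⟨fun t => if T ≤ t then up (t - T).toNat else dn (T - t).toNat, ?_, ?_⟩
  · simp [up]
  · intro t
    by_cases h1 : T ≤ t - 1
    · have h2 : T ≤ t := by omega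
      simp only [h1, h2, if_true]
      obtain ⟨n, hn⟩ : ∃ n : ℕ, t = T + n + 1 := ⟨(t - T - 1).toNat, by omega⟩
      have e1 : (t - 1 - T).toNat = n := by omega
      have e2 : (t - T).toNat = n + 1 := by omega
      rw [e1, e2, hup, hn, hP]
    · by_cases h2 : T ≤ t
      · have : t = T := by omega
        subst this
        simp [up, dn]
      · simp only [h1, h2, if_false]
        obtain ⟨n, hn⟩ : ∃ n : ℕ, t = T - n := ⟨(T - t).toNat, by omega⟩
        have e1 : (T - (t - 1)).toNat = n + 1 := by omega
        have e2 : (T - t).toNat = n := by omega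
        rw [e1, e2, hdn, hn]

/-- simultaneous reflection at the vertices of `S`. -/
noncomputable def stepP (C : CartanADE J) (S : J → Prop) (X : J → J → ℤ) : J → J → ℤ :=
  fun ι => if S ι then - X ι + ∑ j, (if C.a ι j = -1 then X j else 0) else X ι

lemma stepP_invol (C : CartanADE J) (S : J → Prop)
    (hS : ∀ x y, C.a x y = -1 → S x → ¬ S y) (X : J → J → ℤ) :
    stepP C S (stepP C S X) = X := by
  funext ι
  by_cases h : S ι
  · have : ∑ j, (if C.a ι j = -1 then stepP C S X j else 0)
        = ∑ j, (if C.a ι j = -1 then X j else 0) := by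
      refine Finset.sum_congr rfl fun j _ => ?_
      by_cases hj : C.a ι j = -1
      · simp [hj, stepP, hS ι j hj h]
      · simp [hj]
    conv_lhs => unfold stepP
    rw [if_pos h]
    change - stepP C S X ι + ∑ j, (if C.a ι j = -1 then stepP C S X j else 0) = X ι
    rw [this]
    simp [stepP, h]
  · simp [stepP, h]

/-- the time `t` belongs to the class of `ι` -/
def Cls (s ξ : J → ℤ) (t : ℤ) (ι : J) : Prop := 2 * s ι ∣ t - ξ ι

lemma exists_dyn (C : CartanADE J) (s ξ : J → ℤ) (hs : ∀ x, 0 < s x)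
    (hcl : ∀ x y, C.a x y = -1 → ∀ t, Cls s ξ t x → ¬ Cls s ξ t y)
    (hup : ∀ x y, C.a x y = -1 → ξ x ≤ ξ y + 2 * s y) (Λ : J → J → ℤ) :
    ∃ X : ℤ → J → J → ℤ, (∀ t, X (t - 1) = stepP C (Cls s ξ t) (X t)) ∧
      ∀ ι, X (ξ ι) ι = Λ ι := by
  obtain ⟨lo, hlo⟩ : ∃ lo : ℤ, ∀ ι, lo ≤ ξ ι := by
    obtain ⟨b, hb⟩ := (Set.finite_range ξ).bddBelow
    exact ⟨b, fun ι => hb ⟨ι, rfl⟩⟩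
  obtain ⟨hi, hhi⟩ : ∃ hi : ℤ, ∀ ι, ξ ι ≤ hi := by
    obtain ⟨b, hb⟩ := (Set.finite_range ξ).bddAbove
    exact ⟨b, fun ι => hb ⟨ι, rfl⟩⟩
  obtain ⟨Y, hY0, hY⟩ := exists_two_sided
    (fun t => stepP C (fun ι => Cls s ξ t ι ∧ ξ ι < t))
    (fun t x => stepP_invol C _ (fun x y h h1 h2 => hcl x y h t h1.1 h2.1) x) lo Λ
  obtain ⟨X, hX0, hX⟩ := exists_two_sided
    (fun t => stepP C (Cls s ξ t))
    (fun t x => stepP_invol C _ (fun x y h h1 h2 => hcl x y h t h1 h2) x) hi (Y hi)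
  refine ⟨X, hX, ?_⟩
  have key : ∀ n : ℕ, ∀ ι, ξ ι ≤ hi - n → X (hi - n) ι = Y (hi - n) ι := by
    intro n
    induction n with
    | zero => intro ι _; simp [hX0]
    | succ n ih =>
      intro ι h
      have e : hi - ((n + 1 : ℕ) : ℤ) = (hi - n) - 1 := by push_cast; ring
      rw [e] at h ⊢
      rw [hX, hY]
      by_cases hc : Cls s ξ (hi - n) ι
      · have hlt : ξ ι < hi - n := by omega
        simp only [stepP, hc, hlt, and_self, if_true]
        rw [ih ι (by omega)]
        congr 1
        refine Finset.sum_congr rfl fun j _ => ?_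
        by_cases hj : C.a ι j = -1
        · simp only [hj, if_true]
          apply ih
          have h1 := hup j ι (by rw [C.symm]; exact hj)
          obtain ⟨d, hd⟩ := hc
          have hsi := hs ι
          have : 0 < d := by
            by_contra hneg
            have : 2 * s ι * d ≤ 0 := mul_nonpos_of_nonneg_of_nonpos (by omega) (by omega)
            omega
          have : 2 * s ι * 1 ≤ 2 * s ι * d := mul_le_mul_of_nonneg_left (by omega) (by omega)
          omega
        · simp [hj]
      · simp only [stepP, hc, false_and, if_false]
        exact ih ι (by omega)
  have keyY : ∀ n : ℕ, ∀ ι, lo + n ≤ ξ ι → Y (lo + n) ι = Λ ι := by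
    intro n
    induction n with
    | zero => intro ι _; simp [hY0]
    | succ n ih =>
      intro ι h
      have := hY (lo + ((n + 1 : ℕ) : ℤ))
      have e : lo + ((n + 1 : ℕ) : ℤ) - 1 = lo + n := by push_cast; ring
      rw [e] at this
      have h3 := congrFun this ι
      have hn : ¬ (ξ ι < lo + ((n + 1 : ℕ) : ℤ)) := by omega
      simp only [stepP, hn, and_false, if_false] at h3
      rw [← h3]
      apply ih
      push_cast at h
      omega
  intro ι
  obtain ⟨n, hn⟩ : ∃ n : ℕ, ξ ι = hi - n := ⟨(hi - ξ ι).toNat, by have := hhi ι; omega⟩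
  obtain ⟨k, hk⟩ : ∃ n : ℕ, ξ ι = lo + n := ⟨(ξ ι - lo).toNat, by have := hlo ι; omega⟩
  have h1 := key n ι (by omega)
  rw [← hn] at h1
  rw [h1, hk]
  exact keyY k ι (by omega)

lemma dyn_const (C : CartanADE J) (s ξ : J → ℤ) (X : ℤ → J → J → ℤ)
    (hX : ∀ t, X (t - 1) = stepP C (Cls s ξ t) (X t)) (j : J) (q : ℤ) (hq : Cls s ξ q j)
    (d : ℕ) (hd : (d : ℤ) < 2 * s j) : X (q + d) j = X q j := by
  induction d with
  | zero => simp
  | succ d ih =>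
    rw [← ih (by push_cast at hd; omega)]
    have h1 := congrFun (hX (q + ((d + 1 : ℕ) : ℤ))) j
    have e : q + ((d + 1 : ℕ) : ℤ) - 1 = q + d := by push_cast; ring
    have hn : ¬ Cls s ξ (q + ((d + 1 : ℕ) : ℤ)) j := by
      intro h2
      unfold Cls at *
      have h3 : 2 * s j ∣ ((d + 1 : ℕ) : ℤ) := by
        have := dvd_sub h2 hq
        have e2 : q + ((d + 1 : ℕ) : ℤ) - ξ j - (q - ξ j) = ((d + 1 : ℕ) : ℤ) := by ring
        rwa [e2] at this
      have := Int.le_of_dvd (by positivity) h3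
      omega
    rw [e] at h1
    simp only [stepP, hn, if_false] at h1
    exact h1.symm

lemma dyn_stay (C : CartanADE J) (s ξ : J → ℤ) (X : ℤ → J → J → ℤ)
    (hX : ∀ t, X (t - 1) = stepP C (Cls s ξ t) (X t)) (j : J) (t : ℤ) (h : ¬ Cls s ξ t j) :
    X (t - 1) j = X t j := by
  rw [hX t]; simp [stepP, h]

/-! ### weights -/

/-- reflection on weights in fundamental weight coordinates -/
def reflW (C : CartanADE J) (ι : J) : (J → ℤ) →ₗ[ℤ] (J → ℤ) where
  toFun l := fun j => l j - l ι * C.a ι j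
  map_add' x y := by funext j; simp; ring
  map_smul' r x := by funext j; simp; ring

/-- root lattice to weight lattice -/
def toW (C : CartanADE J) : (J → ℤ) →ₗ[ℤ] (J → ℤ) where
  toFun v := fun j => ∑ κ, v κ * C.a κ j
  map_add' x y := by funext j; simp [add_mul, Finset.sum_add_distrib]
  map_smul' r x := by funext j; simp [Finset.mul_sum, mul_assoc]

lemma toW_apply (C : CartanADE J) (v : J → ℤ) (j : J) : toW C v j = ∑ κ, v κ * C.a κ j := rfl
lemma reflW_apply (C : CartanADE J) (ι : J) (v : J → ℤ) (j : J) :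
    reflW C ι v j = v j - v ι * C.a ι j := rfl

lemma toW_simple (C : CartanADE J) (ι j : J) : toW C (simpleRoot ι) j = C.a ι j := by
  simp [toW_apply, simpleRoot]

lemma toW_refl (C : CartanADE J) (ι : J) (v : J → ℤ) :
    toW C (reflS C ι v) = reflW C ι (toW C v) := by
  have e : reflS C ι v = v - (toW C v ι) • simpleRoot ι := by
    funext j; simp [reflS, toW_apply]
  rw [e, map_sub, map_smul]
  funext j
  simp [toW_simple, reflW_apply]

/-- product of reflections on weights -/
def appW (C : CartanADE J) (w : List J) : (J → ℤ) →ₗ[ℤ] (J → ℤ) :=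
  w.foldr (fun ι f => (reflW C ι).comp f) LinearMap.id

lemma appW_append (C : CartanADE J) (w : List J) (ι : J) (v : J → ℤ) :
    appW C (w ++ [ι]) v = appW C w (reflW C ι v) := by
  induction w with
  | nil => simp [appW]
  | cons x w ih =>
    have : appW C (x :: w ++ [ι]) v = reflW C x (appW C (w ++ [ι]) v) := rfl
    rw [this, ih]; rfl

lemma toW_applyRefls (C : CartanADE J) (w : List J) (v : J → ℤ) :
    toW C (applyRefls C w v) = appW C w (toW C v) := by
  induction w with
  | nil => simp [appW, applyRefls]
  | cons x w ih =>
    have : applyRefls C (x :: w) v = reflS C x (applyRefls C w v) := rfl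
    rw [this, toW_refl, ih]; rfl

lemma heightAfter_append (σ : Equiv.Perm J) (ξ : J → ℤ) (w : List J) (ι : J) :
    heightAfter σ ξ (w ++ [ι]) = fun j => heightAfter σ ξ w j -
      if j = ι then 2 * (orbitSize σ ι : ℤ) else 0 := by
  simp [heightAfter]

/-- fundamental weight -/
def fw (ι : J) : J → ℤ := simpleRoot ι

lemma toW_simple_eq (C : CartanADE J) (ι : J) :
    toW C (simpleRoot ι) = (2 : ℤ) • fw ι - ∑ j, (if C.a ι j = -1 then fw j else 0) := by
  funext x
  rw [toW_simple]
  have : (∑ j, (if C.a ι j = -1 then fw j else 0) : J → ℤ) x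
      = if C.a ι x = -1 then 1 else 0 := by
    rw [Finset.sum_apply, Finset.sum_eq_single x]
    · split_ifs <;> simp [fw, simpleRoot]
    · intro b _ hb
      split_ifs
      · simp [fw, simpleRoot, Ne.symm hb]
      · rfl
    · simp
  simp only [Pi.sub_apply, this, Pi.smul_apply]
  by_cases h : x = ι
  · subst h; simp [C.diag, fw, simpleRoot]
  · rcases C.offDiag ι x (Ne.symm h) with h1 | h1 <;> simp [h1, fw, simpleRoot, h]

lemma reflW_fw_self (C : CartanADE J) (ι : J) :
    reflW C ι (fw ι) = fw ι - toW C (simpleRoot ι) := by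
  funext x; simp [reflW_apply, toW_simple, fw, simpleRoot]

lemma reflW_fw_ne (C : CartanADE J) (ι j : J) (h : j ≠ ι) : reflW C ι (fw j) = fw j := by
  funext x; simp [reflW_apply, fw, simpleRoot, Ne.symm h]


lemma dyn_word (C : CartanADE J) (σ : Equiv.Perm J) (s ξ : J → ℤ)
    (hss : ∀ x, s x = (orbitSize σ x : ℤ)) (hs : ∀ x, 0 < s x)
    (hcl : ∀ x y, C.a x y = -1 → ∀ t, Cls s ξ t x → ¬ Cls s ξ t y)
    (hup : ∀ x y, C.a x y = -1 → ξ x ≤ ξ y + 2 * s y)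
    (X : ℤ → J → J → ℤ) (hX : ∀ t, X (t - 1) = stepP C (Cls s ξ t) (X t))
    (hX0 : ∀ ι, X (ξ ι) ι = fw ι) (w : List J) :
    ∀ (hw : ∀ k (hk : k < w.length), IsSource C (heightAfter σ ξ (w.take k)) (w[k])),
    (∀ ι, Cls s ξ (heightAfter σ ξ w ι) ι) ∧
    (∀ x y, C.a x y = -1 → heightAfter σ ξ w x ≤ heightAfter σ ξ w y + 2 * s y) ∧
    (∀ ι, X (heightAfter σ ξ w ι) ι = appW C w (fw ι)) ∧
    (∀ ι, IsSource C (heightAfter σ ξ w) ι →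
      X (heightAfter σ ξ w ι) ι - X (heightAfter σ ξ w ι - 1) ι
        = toW C (applyRefls C w (simpleRoot ι))) := by
  -- the last clause follows from the others
  have last : ∀ w : List J, (∀ ι, Cls s ξ (heightAfter σ ξ w ι) ι) →
    (∀ x y, C.a x y = -1 → heightAfter σ ξ w x ≤ heightAfter σ ξ w y + 2 * s y) →
    (∀ ι, X (heightAfter σ ξ w ι) ι = appW C w (fw ι)) →
    (∀ ι, IsSource C (heightAfter σ ξ w) ι →
      X (heightAfter σ ξ w ι) ι - X (heightAfter σ ξ w ι - 1) ι
        = toW C (applyRefls C w (simpleRoot ι))) := by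
    intro w h1 h2 h3 ι hι
    have hst := congrFun (hX (heightAfter σ ξ w ι)) ι
    rw [stepP, if_pos (h1 ι)] at hst
    have hsum : ∑ j, (if C.a ι j = -1 then X (heightAfter σ ξ w ι) j else 0)
        = appW C w (∑ j, (if C.a ι j = -1 then fw j else 0)) := by
      rw [map_sum]
      refine Finset.sum_congr rfl fun j _ => ?_
      by_cases hj : C.a ι j = -1
      · simp only [hj, if_true]
        rw [← h3 j]
        have hlt := hι j hj
        have hle := h2 ι j hj
        have hne : heightAfter σ ξ w ι ≠ heightAfter σ ξ w j + 2 * s j := by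
          intro he
          apply hcl ι j hj _ (h1 ι)
          have := h1 j
          unfold Cls at this ⊢
          rw [he]
          have e : heightAfter σ ξ w j + 2 * s j - ξ j
            = (heightAfter σ ξ w j - ξ j) + 2 * s j := by ring
          rw [e]
          exact dvd_add this (dvd_refl _)
        have := dyn_const C s ξ X hX j (heightAfter σ ξ w j) (h1 j)
          (heightAfter σ ξ w ι - heightAfter σ ξ w j).toNat (by omega)
        rw [← this]
        congr 1
        omega
      · simp [hj]
    rw [hst, hsum, h3 ι, toW_applyRefls, toW_simple_eq, map_sub, map_smul]
    rw [two_smul]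
    abel
  induction w using List.reverseRecOn with
  | nil =>
    intro hw
    have a1 : ∀ ι, Cls s ξ (heightAfter σ ξ [] ι) ι := by
      intro ι; simp [Cls, heightAfter]
    have a2 : ∀ x y, C.a x y = -1 →
        heightAfter σ ξ [] x ≤ heightAfter σ ξ [] y + 2 * s y := by
      intro x y h; simpa [heightAfter] using hup x y h
    have a3 : ∀ ι, X (heightAfter σ ξ [] ι) ι = appW C [] (fw ι) := by
      intro ι; simpa [heightAfter, appW] using hX0 ι
    exact ⟨a1, a2, a3, last [] a1 a2 a3⟩
  | append_singleton w κ ih =>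
    intro hw
    have hw' : ∀ k (hk : k < w.length), IsSource C (heightAfter σ ξ (w.take k)) (w[k]) := by
      intro k hk
      have := hw k (by simp; omega)
      rw [List.take_append_of_le_length hk.le, List.getElem_append_left hk] at this
      exact this
    have hsrc : IsSource C (heightAfter σ ξ w) κ := by
      have := hw w.length (by simp)
      simpa using this
    obtain ⟨b1, b2, b3, b4⟩ := ih hw'
    have b5 := b4 κ hsrc
    have hη := heightAfter_append σ ξ w κ
    rw [← hss κ] at hη
    have hηκ : heightAfter σ ξ (w ++ [κ]) κ = heightAfter σ ξ w κ - 2 * s κ := by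
      rw [hη]; simp
    have hηn : ∀ j, j ≠ κ → heightAfter σ ξ (w ++ [κ]) j = heightAfter σ ξ w j := by
      intro j hj; rw [hη]; simp [hj]
    have a1 : ∀ ι, Cls s ξ (heightAfter σ ξ (w ++ [κ]) ι) ι := by
      intro ι
      by_cases h : ι = κ
      · subst h
        rw [hηκ]
        have := b1 ι
        unfold Cls at this ⊢
        have e : heightAfter σ ξ w ι - 2 * s ι - ξ ι
          = (heightAfter σ ξ w ι - ξ ι) - 2 * s ι := by ring
        rw [e]
        exact dvd_sub this (dvd_refl _)
      · rw [hηn ι h]; exact b1 ι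
    have a2 : ∀ x y, C.a x y = -1 →
        heightAfter σ ξ (w ++ [κ]) x ≤ heightAfter σ ξ (w ++ [κ]) y + 2 * s y := by
      intro x y hxy
      have hne : x ≠ y := by
        rintro rfl; rw [C.diag] at hxy; omega
      by_cases hx : x = κ
      · subst hx
        rw [hηκ, hηn y (Ne.symm hne)]
        have := b2 x y hxy
        have := hs x
        omega
      · by_cases hy : y = κ
        · subst hy
          rw [hηκ, hηn x hx]
          have := hsrc x (by rw [C.symm]; exact hxy)
          omega
        · rw [hηn x hx, hηn y hy]; exact b2 x y hxy
    have a3 : ∀ ι, X (heightAfter σ ξ (w ++ [κ]) ι) ι = appW C (w ++ [κ]) (fw ι) := by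
      intro ι
      rw [appW_append]
      by_cases h : ι = κ
      · subst h
        have hsι := hs ι
        have := dyn_const C s ξ X hX ι _ (a1 ι) (2 * s ι - 1).toNat (by omega)
        rw [← this, hηκ]
        have e : heightAfter σ ξ w ι - 2 * s ι + ((2 * s ι - 1).toNat : ℤ)
          = heightAfter σ ξ w ι - 1 := by omega
        rw [e, reflW_fw_self, map_sub, ← b3 ι, ← toW_applyRefls, ← b5]
        abel
      · rw [hηn ι h, reflW_fw_ne C κ ι h]; exact b3 ι
    exact ⟨a1, a2, a3, last _ a1 a2 a3⟩

/-! ### positive definiteness -/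

lemma noSub (C : CartanADE J) (v : J → ℤ) (h0 : ∀ x, 0 ≤ v x) (x0 : J) (hx0 : 0 < v x0)
    (h : ∀ x, 0 < v x → ∑ y, C.a x y * v y ≤ 0) : False := by
  have hne : (fun x => (v x : ℚ)) ≠ 0 := by
    intro he
    have := congrFun he x0
    simp at this
    omega
  have := C.posDef _ hne
  have h2 : ∑ x, ∑ y, v x * C.a x y * v y ≤ 0 := by
    refine Finset.sum_nonpos fun x _ => ?_
    have e : ∑ y, v x * C.a x y * v y = v x * ∑ y, C.a x y * v y := by
      rw [Finset.mul_sum]; exact Finset.sum_congr rfl fun y _ => by ring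
    rw [e]
    rcases (h0 x).eq_or_lt with h1 | h1
    · simp [← h1]
    · exact mul_nonpos_of_nonneg_of_nonpos h1.le (h x h1)
  have h3 : ((∑ x, ∑ y, v x * C.a x y * v y : ℤ) : ℚ) ≤ 0 := by exact_mod_cast h2
  push_cast at h3
  linarith

lemma row_le (C : CartanADE J) (v : J → ℤ) (h0 : ∀ x, 0 ≤ v x) (x : J) (T : Finset J)
    (hT : ∀ y ∈ T, C.a x y = -1) : ∑ y, C.a x y * v y ≤ 2 * v x - ∑ y ∈ T, v y := by
  have hx : x ∉ T := by
    intro h; have := hT x h; rw [C.diag] at this; omega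
  have hsub : ∑ y, C.a x y * v y ≤ ∑ y ∈ insert x T, C.a x y * v y := by
    rw [← Finset.sum_sdiff (Finset.subset_univ (insert x T))]
    have : ∑ y ∈ Finset.univ \ insert x T, C.a x y * v y ≤ 0 := by
      refine Finset.sum_nonpos fun y hy => ?_
      simp only [Finset.mem_sdiff, Finset.mem_univ, true_and, Finset.mem_insert, not_or] at hy
      rcases C.offDiag x y (Ne.symm hy.1) with h1 | h1 <;> rw [h1]
      · simp
      · have := h0 y; omega
    linarith
  rw [Finset.sum_insert hx, C.diag] at hsub
  have : ∑ y ∈ T, C.a x y * v y = - ∑ y ∈ T, v y := by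
    rw [← Finset.sum_neg_distrib]
    exact Finset.sum_congr rfl fun y hy => by rw [hT y hy]; ring
  linarith

lemma row_le1 (C : CartanADE J) (v : J → ℤ) (h0 : ∀ x, 0 ≤ v x) (x y : J)
    (hy : C.a x y = -1) : ∑ y, C.a x y * v y ≤ 2 * v x - v y := by
  have := row_le C v h0 x {y} (by simpa using hy)
  simpa using this

lemma row_le2 (C : CartanADE J) (v : J → ℤ) (h0 : ∀ x, 0 ≤ v x) (x y z : J)
    (hy : C.a x y = -1) (hz : C.a x z = -1) (hyz : y ≠ z) :
    ∑ y, C.a x y * v y ≤ 2 * v x - (v y + v z) := by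
  have := row_le C v h0 x {y, z} (by simp [hy, hz])
  rwa [Finset.sum_pair hyz] at this

lemma row_le3 (C : CartanADE J) (v : J → ℤ) (h0 : ∀ x, 0 ≤ v x) (x y z u : J)
    (hy : C.a x y = -1) (hz : C.a x z = -1) (hu : C.a x u = -1)
    (hyz : y ≠ z) (hyu : y ≠ u) (hzu : z ≠ u) :
    ∑ y, C.a x y * v y ≤ 2 * v x - (v y + (v z + v u)) := by
  have := row_le C v h0 x {y, z, u} (by simp [hy, hz, hu])
  rwa [Finset.sum_insert (by simp [hyz, hyu]), Finset.sum_pair hzu] at this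

lemma toW_inj (C : CartanADE J) (v : J → ℤ) (h : toW C v = 0) : v = 0 := by
  by_contra hv
  have hne : (fun x => (v x : ℚ)) ≠ 0 := by
    intro he
    apply hv
    funext x
    have := congrFun he x
    simpa using this
  have := C.posDef _ hne
  rw [Finset.sum_comm] at this
  have h3 : ∑ y, ∑ x, (v x : ℚ) * C.a x y * v y = ((∑ y, (toW C v y) * v y : ℤ) : ℚ) := by
    push_cast
    refine Finset.sum_congr rfl fun y _ => ?_
    rw [toW_apply]; push_cast; rw [Finset.sum_mul]
  rw [h3, h] at this
  simp at this

lemma posRoots_finite (C : CartanADE J) : (posRoots C).Finite := by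
  -- dual vectors
  let f : (J → ℚ) →ₗ[ℚ] (J → ℚ) :=
    { toFun := fun v j => ∑ κ, v κ * (C.a κ j : ℚ)
      map_add' := by intro x y; funext j; simp [add_mul, Finset.sum_add_distrib]
      map_smul' := by intro r x; funext j; simp [Finset.mul_sum, mul_assoc] }
  have hf : ∀ v j, f v j = ∑ κ, v κ * (C.a κ j : ℚ) := fun v j => rfl
  have hinj : Function.Injective f := by
    rw [injective_iff_map_eq_zero]
    intro v hv
    by_contra hne
    have := C.posDef v hne
    rw [Finset.sum_comm] at this
    have e : ∑ y, ∑ x, v x * (C.a x y : ℚ) * v y = ∑ y, f v y * v y :=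
      Finset.sum_congr rfl fun y _ => by rw [hf, Finset.sum_mul]
    rw [e, hv] at this
    simp at this
  have hsurj : Function.Surjective f := LinearMap.surjective_of_injective hinj
  have hb : ∀ ι : J, ∃ N : ℤ, ∀ v ∈ posRoots C, v ι ≤ N := by
    intro ι
    obtain ⟨u, hu⟩ := hsurj (fun j => if j = ι then 1 else 0)
    let q := ∑ x, ∑ y, u x * (C.a x y : ℚ) * u y
    refine ⟨⌈1 + q / 2⌉, fun v hv => ?_⟩
    have hnn : 0 ≤ ∑ x, ∑ y, ((v x : ℚ) - u x) * (C.a x y : ℚ) * ((v y : ℚ) - u y) := by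
      by_cases h0 : (fun x => (v x : ℚ) - u x) = 0
      · have : ∀ x, (v x : ℚ) - u x = 0 := fun x => congrFun h0 x
        simp [this]
      · exact (C.posDef _ h0).le
    have e1 : ∑ x, ∑ y, u x * (C.a x y : ℚ) * (v y : ℚ) = v ι := by
      rw [Finset.sum_comm]
      have : ∀ y, ∑ x, u x * (C.a x y : ℚ) * (v y : ℚ) = f u y * v y := by
        intro y; rw [hf, Finset.sum_mul]
      simp [this, hu]
    have e2 : ∑ x, ∑ y, (v x : ℚ) * (C.a x y : ℚ) * u y = v ι := by
      rw [← e1, Finset.sum_comm]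
      refine Finset.sum_congr rfl fun x _ => Finset.sum_congr rfl fun y _ => ?_
      rw [C.symm]; ring
    have e3 : ∑ x, ∑ y, (v x : ℚ) * (C.a x y : ℚ) * v y = 2 := by
      have := hv.2.2
      unfold pairing at this
      exact_mod_cast this
    have e4 : ∑ x, ∑ y, ((v x : ℚ) - u x) * (C.a x y : ℚ) * ((v y : ℚ) - u y)
        = ∑ x, ∑ y, (v x : ℚ) * (C.a x y : ℚ) * v y
        - ∑ x, ∑ y, (v x : ℚ) * (C.a x y : ℚ) * u y
        - ∑ x, ∑ y, u x * (C.a x y : ℚ) * (v y : ℚ) + q := by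
      simp only [q, ← Finset.sum_sub_distrib, ← Finset.sum_add_distrib]
      refine Finset.sum_congr rfl fun x _ => Finset.sum_congr rfl fun y _ => ?_
      ring
    rw [e4, e1, e2, e3] at hnn
    have : (v ι : ℚ) ≤ 1 + q / 2 := by linarith
    exact_mod_cast this.trans (Int.le_ceil _)
  choose N hN using hb
  refine (Set.finite_Icc (0 : J → ℤ) N).subset fun v hv => ?_
  exact ⟨fun x => hv.1 x, fun x => hN x v hv⟩

lemma sum_posRoots (C : CartanADE J) {L : ℕ} (ii : Fin L → J) (hr : IsReducedWord C ii)
    (m : (J → ℤ) → ℤ) :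
    ∑ᶠ v ∈ posRoots C, m v • v = ∑ k, m (betaOf C ii k) • betaOf C ii k := by
  have hfin := posRoots_finite C
  have hR : Set.range (betaOf C ii) = posRoots C := by
    apply Set.eq_of_subset_of_ncard_le _ _ hfin
    · rintro _ ⟨k, rfl⟩; exact hr.2.2 k
    · rw [← hr.1, ← Set.image_univ, Set.ncard_image_of_injective _ hr.2.1]
      simp
  rw [← hR, finsum_mem_range hr.2.1, finsum_eq_sum_of_fintype]


/-! ### orbits -/

lemma pow_orderOf_apply (σ : Equiv.Perm J) (x : J) : (σ ^ orderOf σ) x = x := by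
  rw [pow_orderOf_eq_one]; rfl

lemma isPer_iff (σ : Equiv.Perm J) (x : J) (n : ℕ) :
    Function.IsPeriodicPt σ n x ↔ (σ ^ n) x = x := by
  unfold Function.IsPeriodicPt Function.IsFixedPt
  rw [Equiv.Perm.iterate_eq_pow]

lemma mem_per (σ : Equiv.Perm J) (x : J) : x ∈ Function.periodicPts σ :=
  ⟨orderOf σ, orderOf_pos σ, (isPer_iff σ x _).2 (pow_orderOf_apply σ x)⟩

lemma orbitSize_eq (σ : Equiv.Perm J) (x : J) : orbitSize σ x = Function.minimalPeriod σ x := by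
  have hpos := Function.minimalPeriod_pos_of_mem_periodicPts (mem_per σ x)
  have hle : Function.minimalPeriod σ x ≤ orderOf σ :=
    Function.IsPeriodicPt.minimalPeriod_le (orderOf_pos σ)
      ((isPer_iff σ x _).2 (pow_orderOf_apply σ x))
  have : ((Finset.range (orderOf σ)).image fun k => (σ ^ k) x)
      = (Finset.range (Function.minimalPeriod σ x)).image fun k => (σ ^ k) x := by
    ext y
    simp only [Finset.mem_image, Finset.mem_range]
    constructor
    · rintro ⟨k, hk, rfl⟩
      refine ⟨k % Function.minimalPeriod σ x, Nat.mod_lt _ hpos, ?_⟩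
      rw [← Equiv.Perm.iterate_eq_pow, ← Equiv.Perm.iterate_eq_pow,
        Function.iterate_mod_minimalPeriod_eq]
    · rintro ⟨k, hk, rfl⟩
      exact ⟨k, by omega, rfl⟩
  unfold orbitSize
  rw [this, Finset.card_image_of_injOn, Finset.card_range]
  intro a ha b hb hab
  apply Function.iterate_injOn_Iio_minimalPeriod (f := σ) (x := x)
  · simpa using ha
  · simpa using hb
  · simpa only [Equiv.Perm.iterate_eq_pow] using hab

lemma orbitSize_pos (σ : Equiv.Perm J) (x : J) : 0 < orbitSize σ x := by
  rw [orbitSize_eq]; exact Function.minimalPeriod_pos_of_mem_periodicPts (mem_per σ x)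

lemma orbitSize_one (σ : Equiv.Perm J) (x : J) : orbitSize σ x = 1 ↔ σ x = x := by
  rw [orbitSize_eq, Function.minimalPeriod_eq_one_iff_isFixedPt]; rfl

lemma orbitSize_pow (σ : Equiv.Perm J) (x : J) (k : ℕ) :
    orbitSize σ ((σ ^ k) x) = orbitSize σ x := by
  rw [orbitSize_eq, orbitSize_eq, ← Equiv.Perm.iterate_eq_pow,
    Function.minimalPeriod_apply_iterate (mem_per σ x)]

lemma pow_orbitSize (σ : Equiv.Perm J) (x : J) : (σ ^ orbitSize σ x) x = x := by
  rw [← isPer_iff, orbitSize_eq]; exact Function.isPeriodicPt_minimalPeriod _ _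

lemma orbitSize_dvd (σ : Equiv.Perm J) (x : J) (k : ℕ) (h : (σ ^ k) x = x) :
    orbitSize σ x ∣ k := by
  rw [orbitSize_eq]; exact ((isPer_iff σ x k).2 h).minimalPeriod_dvd

lemma SameOrbit.sym {σ : Equiv.Perm J} {x y : J} (h : SameOrbit σ x y) : SameOrbit σ y x := by
  obtain ⟨k, rfl⟩ := h
  refine ⟨orderOf σ * k - k, ?_⟩
  rw [← Equiv.Perm.mul_apply, ← pow_add, Nat.sub_add_cancel
    (Nat.le_mul_of_pos_left k (orderOf_pos σ)), pow_mul, pow_orderOf_eq_one, one_pow]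
  rfl

lemma SameOrbit.tr {σ : Equiv.Perm J} {x y z : J} (h : SameOrbit σ x y) (h' : SameOrbit σ y z) :
    SameOrbit σ x z := by
  obtain ⟨k, rfl⟩ := h
  obtain ⟨l, rfl⟩ := h'
  exact ⟨l + k, by rw [pow_add]; rfl⟩

lemma SameOrbit.rfl' {σ : Equiv.Perm J} {x : J} : SameOrbit σ x x := ⟨0, by simp⟩

lemma SameOrbit.size {σ : Equiv.Perm J} {x y : J} (h : SameOrbit σ x y) :
    orbitSize σ y = orbitSize σ x := by
  obtain ⟨k, rfl⟩ := h; exact orbitSize_pow σ x k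

lemma compat_pow {C : CartanADE J} (D : DiagAut C) (k : ℕ) (x y : J) :
    C.a ((D.σ ^ k) x) ((D.σ ^ k) y) = C.a x y := by
  induction k with
  | zero => simp
  | succ k ih => rw [pow_succ']; simp only [Equiv.Perm.mul_apply]; rw [D.compat, ih]

lemma fixed_pow {σ : Equiv.Perm J} {x : J} (h : σ x = x) (k : ℕ) : (σ ^ k) x = x := by
  induction k with
  | zero => simp
  | succ k ih => rw [pow_succ']; simp only [Equiv.Perm.mul_apply]; rw [ih, h]

lemma adj_ne {C : CartanADE J} {x y : J} (h : C.a x y = -1) : x ≠ y := by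
  rintro rfl; rw [C.diag] at h; omega

/-! ### walks -/

/-- `p` restricted to `0..n` is a walk -/
def IsWk (C : CartanADE J) (p : ℕ → J) (n : ℕ) : Prop := ∀ i < n, C.a (p i) (p (i + 1)) = -1

lemma wk_connected (C : CartanADE J) (x y : J) : ∃ n p, IsWk C p n ∧ p 0 = x ∧ p n = y := by
  have := C.indec {y | ∃ n p, IsWk C p n ∧ p 0 = x ∧ p n = y}
    ⟨x, 0, fun _ => x, by intro i hi; omega, rfl, rfl⟩ (by
      rintro z ⟨n, p, hp, h0, hn⟩ j hj
      refine ⟨n + 1, fun i => if i ≤ n then p i else j, ?_, by simp [h0], by simp⟩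
      intro i hi
      by_cases h : i < n
      · have h1 : i ≤ n := by omega
        have h2 : i + 1 ≤ n := by omega
        simp only [h1, h2, if_true]; exact hp i h
      · have h1 : i = n := by omega
        subst h1
        simp [hn, hj])
  have hy : y ∈ (Set.univ : Set J) := trivial
  rw [← this] at hy
  exact hy

lemma wk_reduce (C : CartanADE J) (p : ℕ → J) (n i : ℕ) (hp : IsWk C p n)
    (hi : i + 2 ≤ n) (h : p i = p (i + 2)) :
    ∃ q, IsWk C q (n - 2) ∧ q 0 = p 0 ∧ q (n - 2) = p n := by
  refine ⟨fun j => if j ≤ i then p j else p (j + 2), ?_, by simp, ?_⟩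
  · intro j hj
    by_cases h1 : j < i
    · have h2 : j ≤ i := by omega
      have h3 : j + 1 ≤ i := by omega
      simp only [h2, h3, if_true]; exact hp j (by omega)
    · by_cases h2 : j = i
      · subst h2
        simp only [le_refl, if_true, show ¬ (j + 1 ≤ j) by omega, if_false]
        rw [h]; exact hp (j + 2) (by omega)
      · simp only [show ¬ j ≤ i by omega, show ¬ j + 1 ≤ i by omega, if_false]
        have := hp (j + 2) (by omega)
        rw [show j + 1 + 2 = j + 2 + 1 by ring]; exact this
  · by_cases h1 : n - 2 ≤ i
    · have : n - 2 = i := by omega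
      simp only [this, le_refl, if_true]
      rw [h]; congr 1; omega
    · simp only [h1, if_false]; congr 1; omega

lemma exists_fixed {C : CartanADE J} (D : DiagAut C) (x0 : J) : ∃ f, D.σ f = f := by
  have hex : ∃ n, ∃ p, IsWk C p n ∧ p n = D.σ (p 0) := by
    obtain ⟨n, p, hp, h0, hn⟩ := wk_connected C x0 (D.σ x0)
    exact ⟨n, p, hp, by rw [hn, h0]⟩
  classical
  obtain ⟨p, hp, hpn⟩ := Nat.find_spec hex
  have hmin : ∀ k < Nat.find hex, ¬ ∃ p, IsWk C p k ∧ p k = D.σ (p 0) :=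
    fun k hk => Nat.find_min hex hk
  generalize Nat.find hex = n at *
  by_contra hno
  push Not at hno
  have hn0 : n ≠ 0 := by
    rintro rfl; exact hno _ hpn.symm
  have hn1 : n ≠ 1 := by
    rintro rfl
    have := hp 0 (by omega)
    simp only [zero_add] at this
    rw [hpn] at this
    have h2 := D.noAdj (p 0) 1
    simp only [pow_one] at h2
    exact h2 (hno _) this
  let S : Set J := {x | ∃ i < n, SameOrbit D.σ (p i) x}
  have hSle : ∀ i ≤ n, ∀ k, (D.σ ^ k) (p i) ∈ S := by
    intro i hi k
    rcases hi.lt_or_eq with h | h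
    · exact ⟨i, h, k, rfl⟩
    · subst h
      exact ⟨0, by omega, k + 1, by rw [hpn, pow_succ]; rfl⟩
  let v : J → ℤ := fun x => if x ∈ S then 1 else 0
  have hv0 : ∀ x, 0 ≤ v x := by intro x; simp only [v]; split_ifs <;> omega
  have hv1 : ∀ x ∈ S, v x = 1 := by intro x hx; simp [v, hx]
  refine noSub C v hv0 (p 0) (by rw [hv1 _ (by simpa using hSle 0 (by omega) 0)]; omega) ?_
  intro x hx
  have hxS : x ∈ S := by
    by_contra h; simp [v, h] at hx
  have hvx := hv1 x hxS
  obtain ⟨i, hi, k, rfl⟩ := hxS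
  rcases Nat.eq_zero_or_pos i with h0 | h0
  · subst h0
    -- neighbours `p 1` and `σ⁻¹ (p (n-1))`
    obtain ⟨l, hl⟩ : SameOrbit D.σ (D.σ (p (n - 1))) (p (n - 1)) := SameOrbit.sym ⟨1, by simp⟩
    have hzz : ∃ z, D.σ z = p (n - 1) ∧ SameOrbit D.σ (p (n - 1)) z := by
      refine ⟨D.σ.symm (p (n - 1)), by simp, SameOrbit.sym ⟨1, by simp⟩⟩
    obtain ⟨z, hz, l, hl⟩ := hzz
    have ha1 := hp 0 (by omega)
    have ha2 : C.a (p 0) z = -1 := by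
      rw [← D.compat, hz, C.symm, ← hpn]
      have := hp (n - 1) (by omega)
      rwa [show n - 1 + 1 = n by omega] at this
    have hne : p 1 ≠ z := by
      intro he
      apply hmin (n - 2) (by omega)
      refine ⟨fun j => p (j + 1), fun j hj => hp (j + 1) (by omega), ?_⟩
      change p (n - 2 + 1) = D.σ (p (0 + 1))
      rw [zero_add, he, hz]; congr 1; omega
    have hr := row_le2 C v hv0 ((D.σ ^ k) (p 0)) ((D.σ ^ k) (p 1)) ((D.σ ^ k) z)
      (by rw [compat_pow]; exact ha1) (by rw [compat_pow]; exact ha2)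
      (fun h => hne ((D.σ ^ k).injective h))
    rw [hvx, hv1 _ (hSle 1 (by omega) k), hv1 ((D.σ ^ k) z)
      ⟨n - 1, by omega, SameOrbit.tr ⟨l, hl⟩ ⟨k, rfl⟩⟩] at hr
    linarith
  · obtain ⟨i, rfl⟩ : ∃ i', i = i' + 1 := ⟨i - 1, by omega⟩
    have hne : p i ≠ p (i + 2) := by
      intro he
      obtain ⟨q, hq, hq0, hqn⟩ := wk_reduce C p n i hp (by omega) he
      exact hmin (n - 2) (by omega) ⟨q, hq, by rw [hqn, hq0, hpn]⟩
    have hr := row_le2 C v hv0 ((D.σ ^ k) (p (i + 1))) ((D.σ ^ k) (p i)) ((D.σ ^ k) (p (i + 2)))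
      (by rw [compat_pow, C.symm]; exact hp i (by omega))
      (by rw [compat_pow]; exact hp (i + 1) (by omega))
      (fun h => hne ((D.σ ^ k).injective h))
    rw [hvx, hv1 _ (hSle i (by omega) k), hv1 _ (hSle (i + 2) (by omega) k)] at hr
    linarith

lemma small_fixed {C : CartanADE J} (D : DiagAut C) (ι j : J) (hadj : C.a ι j = -1)
    (hlt : orbitSize D.σ ι < orbitSize D.σ j) : D.σ ι = ι := by
  by_contra hnf
  have hs1 : orbitSize D.σ ι ≠ 1 := fun h => hnf ((orbitSize_one _ _).1 h)
  have hspos := orbitSize_pos D.σ ι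
  -- properties of the two orbits
  have H1 : ∀ x, SameOrbit D.σ ι x → ∃ y z, SameOrbit D.σ j y ∧ SameOrbit D.σ j z ∧ y ≠ z ∧
      C.a x y = -1 ∧ C.a x z = -1 := by
    rintro x ⟨k, rfl⟩
    refine ⟨(D.σ ^ k) j, (D.σ ^ k) ((D.σ ^ orbitSize D.σ ι) j), ⟨k, rfl⟩,
      SameOrbit.tr ⟨_, rfl⟩ ⟨k, rfl⟩, ?_, by rw [compat_pow]; exact hadj, ?_⟩
    · intro h
      have h2 := (D.σ ^ k).injective h
      have := Nat.le_of_dvd hspos (orbitSize_dvd D.σ j _ h2.symm)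
      omega
    · rw [compat_pow]
      have := compat_pow D (orbitSize D.σ ι) ι j
      rw [pow_orbitSize, hadj] at this
      exact this
  have H2 : ∀ y, SameOrbit D.σ j y → ∃ x, SameOrbit D.σ ι x ∧ C.a y x = -1 := by
    rintro y ⟨k, rfl⟩
    exact ⟨(D.σ ^ k) ι, ⟨k, rfl⟩, by rw [compat_pow, C.symm]; exact hadj⟩
  have N1 : ∀ x, SameOrbit D.σ ι x → D.σ x ≠ x := by
    intro x hx h
    rw [← orbitSize_one, hx.size] at h; exact hs1 h
  have N2 : ∀ x, SameOrbit D.σ j x → D.σ x ≠ x := by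
    intro x hx h
    rw [← orbitSize_one, hx.size] at h; omega
  have N3 : ∀ x, SameOrbit D.σ ι x → ¬ SameOrbit D.σ j x := by
    intro x hx h
    have h1 := hx.size
    have h2 := h.size
    omega
  obtain ⟨f, hf⟩ := exists_fixed D ι
  have hex : ∃ n, ∃ p, IsWk C p n ∧ D.σ (p 0) = p 0 ∧
      (SameOrbit D.σ ι (p n) ∨ SameOrbit D.σ j (p n)) := by
    obtain ⟨n, p, hp, h0, hn⟩ := wk_connected C f ι
    exact ⟨n, p, hp, by rw [h0, hf], Or.inl (by rw [hn]; exact SameOrbit.rfl')⟩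
  obtain ⟨p, hp, hp0, hpn⟩ := Nat.find_spec hex
  have hmin : ∀ k < Nat.find hex, ¬ ∃ p, IsWk C p k ∧ D.σ (p 0) = p 0 ∧
      (SameOrbit D.σ ι (p k) ∨ SameOrbit D.σ j (p k)) :=
    fun k hk => Nat.find_min hex hk
  generalize Nat.find hex = n at *
  have hn0 : 0 < n := by
    rcases Nat.eq_zero_or_pos n with h | h
    · subst h
      rcases hpn with h | h
      · exact absurd hp0 (N1 _ h)
      · exact absurd hp0 (N2 _ h)
    · exact h
  have hp1 : D.σ (p 1) ≠ p 1 := by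
    intro h
    apply hmin (n - 1) (by omega)
    refine ⟨fun i => p (i + 1), fun i hi => hp (i + 1) (by omega), h, ?_⟩
    change SameOrbit D.σ ι (p (n - 1 + 1)) ∨ SameOrbit D.σ j (p (n - 1 + 1))
    rwa [show n - 1 + 1 = n by omega]
  have hnot : ∀ i < n, ¬ (SameOrbit D.σ ι (p i) ∨ SameOrbit D.σ j (p i)) := by
    intro i hi h
    exact hmin i hi ⟨p, fun k hk => hp k (by omega), hp0, h⟩
  have hback : ∀ i, i + 2 ≤ n → p i ≠ p (i + 2) := by
    intro i hi he
    obtain ⟨q, hq, hq0, hqn⟩ := wk_reduce C p n i hp hi he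
    exact hmin (n - 2) (by omega) ⟨q, hq, by rw [hq0, hp0], by rw [hqn]; exact hpn⟩
  let S : Set J := {x | ∃ i ≤ n, SameOrbit D.σ (p i) x}
  have hS : ∀ i ≤ n, ∀ k, (D.σ ^ k) (p i) ∈ S := fun i hi k => ⟨i, hi, k, rfl⟩
  -- interior vertices
  have hinner : ∀ (v : J → ℤ) (c : ℤ), (∀ x, 0 ≤ v x) → (∀ x ∈ S, v x = c) → ∀ i < n, ∀ k,
      ∑ y, C.a ((D.σ ^ k) (p i)) y * v y ≤ 0 := by
    intro v c hv hc i hi k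
    rcases Nat.eq_zero_or_pos i with h0 | h0
    · subst h0
      have ha := hp 0 (by omega)
      have ha2 : C.a (p 0) (D.σ (p 1)) = -1 := by
        rw [← hp0, D.compat]; exact ha
      have hr := row_le2 C v hv ((D.σ ^ k) (p 0)) ((D.σ ^ k) (p 1)) ((D.σ ^ k) (D.σ (p 1)))
        (by rw [compat_pow]; exact ha) (by rw [compat_pow]; exact ha2)
        (fun h => hp1 ((D.σ ^ k).injective h).symm)
      rw [hc _ (hS 0 (by omega) k), hc _ (hS 1 (by omega) k),
        hc ((D.σ ^ k) (D.σ (p 1))) ⟨1, by omega, k + 1, by rw [pow_succ]; rfl⟩] at hr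
      linarith
    · obtain ⟨i, rfl⟩ : ∃ i', i = i' + 1 := ⟨i - 1, by omega⟩
      have hr := row_le2 C v hv ((D.σ ^ k) (p (i + 1))) ((D.σ ^ k) (p i))
        ((D.σ ^ k) (p (i + 2)))
        (by rw [compat_pow, C.symm]; exact hp i (by omega))
        (by rw [compat_pow]; exact hp (i + 1) (by omega))
        (fun h => hback i (by omega) ((D.σ ^ k).injective h))
      rw [hc _ (hS (i + 1) (by omega) k), hc _ (hS i (by omega) k),
        hc _ (hS (i + 2) (by omega) k)] at hr
      linarith
  have hlast : C.a (p n) (p (n - 1)) = -1 := by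
    have := hp (n - 1) (by omega)
    rw [show n - 1 + 1 = n by omega] at this
    rw [C.symm]; exact this
  have hnn := hnot (n - 1) (by omega)
  rcases hpn with hpn | hpn
  · -- the walk ends in the small orbit
    have hdis : ∀ x ∈ S, ¬ SameOrbit D.σ j x := by
      rintro x ⟨i, hi, hix⟩ hx
      have hj : SameOrbit D.σ j (p i) := hx.tr hix.sym
      rcases hi.lt_or_eq with h | h
      · exact hnot i h (Or.inr hj)
      · subst h; exact N3 _ hpn hj
    let v : J → ℤ := fun x => if x ∈ S then 2 else if SameOrbit D.σ j x then 1 else 0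
    have hv0 : ∀ x, 0 ≤ v x := by intro x; simp only [v]; split_ifs <;> omega
    have hvS : ∀ x ∈ S, v x = 2 := by intro x hx; simp [v, hx]
    have hvO : ∀ x, SameOrbit D.σ j x → v x = 1 := by
      intro x hx
      have : x ∉ S := fun h => hdis x h hx
      simp [v, hx, this]
    refine noSub C v hv0 (p 0) (by rw [hvS _ (by simpa using hS 0 (by omega) 0)]; omega) ?_
    intro x hx
    by_cases hxS : x ∈ S
    · obtain ⟨i, hi, k, rfl⟩ := hxS
      rcases hi.lt_or_eq with h | h
      · exact hinner v 2 hv0 hvS i h k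
      · subst h
        obtain ⟨y, z, hy, hz, hyz, hay, haz⟩ := H1 _ (hpn.tr ⟨k, rfl⟩)
        have hmem := hS (i - 1) (by omega) k
        have hr := row_le3 C v hv0 ((D.σ ^ k) (p i)) ((D.σ ^ k) (p (i - 1))) y z
          (by rw [compat_pow]; exact hlast) hay haz
          (fun h => hdis _ hmem (h ▸ hy)) (fun h => hdis _ hmem (h ▸ hz)) hyz
        rw [hvS _ (hS i le_rfl k), hvS _ hmem, hvO y hy, hvO z hz] at hr
        linarith
    · have hxO : SameOrbit D.σ j x := by
        by_contra h; simp [v, hxS, h] at hx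
      obtain ⟨y, hy, hay⟩ := H2 x hxO
      have hr := row_le1 C v hv0 x y hay
      rw [hvO x hxO, hvS y ⟨n, le_rfl, hpn.sym.tr hy⟩] at hr
      linarith
  · -- the walk ends in the large orbit
    let v : J → ℤ := fun x => if x ∈ S ∨ SameOrbit D.σ ι x then 1 else 0
    have hv0 : ∀ x, 0 ≤ v x := by intro x; simp only [v]; split_ifs <;> omega
    have hvS : ∀ x ∈ S, v x = 1 := by intro x hx; simp [v, hx]
    have hvO : ∀ x, SameOrbit D.σ ι x → v x = 1 := by intro x hx; simp [v, hx]
    refine noSub C v hv0 (p 0) (by rw [hvS _ (by simpa using hS 0 (by omega) 0)]; omega) ?_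
    intro x hx
    by_cases hxS : x ∈ S
    · obtain ⟨i, hi, k, rfl⟩ := hxS
      rcases hi.lt_or_eq with h | h
      · exact hinner v 1 hv0 hvS i h k
      · subst h
        obtain ⟨y, hy, hay⟩ := H2 _ (hpn.tr ⟨k, rfl⟩)
        have hmem := hS (i - 1) (by omega) k
        have hr := row_le2 C v hv0 ((D.σ ^ k) (p i)) ((D.σ ^ k) (p (i - 1))) y
          (by rw [compat_pow]; exact hlast) hay
          (fun h => hnn (Or.inl (hy.tr (SameOrbit.sym ⟨k, h⟩))))
        rw [hvS _ (hS i le_rfl k), hvS _ hmem, hvO y hy] at hr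
        linarith
    · have hxO : SameOrbit D.σ ι x := by
        by_contra h; simp [v, hxS, h] at hx
      obtain ⟨y, z, hy, hz, hyz, hay, haz⟩ := H1 x hxO
      have hr := row_le2 C v hv0 x y z hay haz hyz
      rw [hvO x hxO, hvS y ⟨n, le_rfl, hpn.sym.tr hy⟩, hvS z ⟨n, le_rfl, hpn.sym.tr hz⟩] at hr
      linarith


/-! ### heights -/

/-- descending pattern modulo `2 |σ|` -/
def Desc (σ : Equiv.Perm J) (ξ : J → ℤ) (x : J) : Prop :=
  orbitSize σ x = orderOf σ ∧
    ∀ k : ℕ, 2 * (orderOf σ : ℤ) ∣ ξ ((σ ^ k) x) - ξ x + 2 * (k : ℤ)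

lemma desc_of_exists (σ : Equiv.Perm J) (ξ : J → ℤ) (j j0 : J) (h : SameOrbit σ j j0)
    (hk : ∀ k : ℕ, k < orderOf σ → ξ ((σ ^ k) j0) = ξ j0 - 2 * (k : ℤ)) : Desc σ ξ j := by
  have hpos := orderOf_pos σ
  have all : ∀ k : ℕ, 2 * (orderOf σ : ℤ) ∣ ξ ((σ ^ k) j0) - ξ j0 + 2 * (k : ℤ) := by
    intro k
    have h1 := hk (k % orderOf σ) (Nat.mod_lt _ hpos)
    rw [pow_mod_orderOf] at h1
    rw [h1]
    refine ⟨(k / orderOf σ : ℕ), ?_⟩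
    have h2 : ((orderOf σ * (k / orderOf σ) + k % orderOf σ : ℕ) : ℤ) = k := by
      rw [Nat.div_add_mod]
    push_cast at h2 ⊢
    linarith
  constructor
  · rw [← h.size]
    have h1 := orbitSize_dvd σ j0 _ (pow_orderOf_apply σ j0)
    have h2 := Nat.le_of_dvd hpos h1
    rcases h2.lt_or_eq with h3 | h3
    · have h4 := hk _ h3
      rw [pow_orbitSize] at h4
      have := orbitSize_pos σ j0
      omega
    · exact h3
  · intro k
    obtain ⟨l, rfl⟩ := h.sym
    have h1 := all (k + l)
    have h2 := all l
    have e : (σ ^ k) ((σ ^ l) j0) = (σ ^ (k + l)) j0 := by rw [pow_add]; rfl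
    rw [e]
    have := dvd_sub h1 h2
    have e2 : ξ ((σ ^ (k + l)) j0) - ξ j0 + 2 * ((k + l : ℕ) : ℤ)
        - (ξ ((σ ^ l) j0) - ξ j0 + 2 * (l : ℤ))
        = ξ ((σ ^ (k + l)) j0) - ξ ((σ ^ l) j0) + 2 * (k : ℤ) := by push_cast; ring
    rwa [e2] at this

lemma dichotomy {C : CartanADE J} (D : DiagAut C) (ξ : J → ℤ) (hξ : IsHeightFunction C D ξ)
    (x : J) : D.σ x = x ∨ Desc D.σ ξ x := by
  obtain ⟨f, hf⟩ := exists_fixed D x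
  have := C.indec {x | D.σ x = x ∨ Desc D.σ ξ x} ⟨f, Or.inl hf⟩ (by
    intro x hx y hxy
    have hyx : C.a y x = -1 := by rw [C.symm]; exact hxy
    rcases lt_trichotomy (orbitSize D.σ x) (orbitSize D.σ y) with h | h | h
    · obtain ⟨j0, ⟨h1, h2, h3⟩, -⟩ := hξ.2 x y hxy h
      exact Or.inr (desc_of_exists D.σ ξ y j0 h1 h3)
    · rcases hx with hx | ⟨hx1, hx2⟩
      · left
        rw [← orbitSize_one, ← h, orbitSize_one]; exact hx
      · right
        refine ⟨by rw [← h, hx1], fun k => ?_⟩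
        have e0 := hξ.1 x y hxy h
        have ek := hξ.1 _ _ ((compat_pow D k x y).trans hxy)
          (by rw [orbitSize_pow, orbitSize_pow, h])
        rw [orbitSize_pow, hx1] at ek
        rw [hx1] at e0
        obtain ⟨d, hd⟩ := hx2 k
        rcases (abs_eq (by positivity)).1 e0 with e0 | e0 <;>
        rcases (abs_eq (by positivity)).1 ek with ek | ek
        · exact ⟨d, by linarith⟩
        · exact ⟨d + 1, by linarith⟩
        · exact ⟨d - 1, by linarith⟩
        · exact ⟨d, by linarith⟩
    · exact Or.inl (small_fixed D y x hyx h))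
  have hy : x ∈ (Set.univ : Set J) := trivial
  rw [← this] at hy
  exact hy

lemma distinct {C : CartanADE J} (D : DiagAut C) (ξ : J → ℤ) (hξ : IsHeightFunction C D ξ)
    (x y : J) (t : ℤ) (h : SameOrbit D.σ x y)
    (hx : Cls (fun z => (orbitSize D.σ z : ℤ)) ξ t x)
    (hy : Cls (fun z => (orbitSize D.σ z : ℤ)) ξ t y) : x = y := by
  have hsz := h.size
  obtain ⟨k, rfl⟩ := h
  rcases dichotomy D ξ hξ x with h | ⟨h1, h2⟩
  · rw [fixed_pow h]
  · unfold Cls at hx hy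
    simp only [hsz, h1] at hx hy
    have h3 := h2 k
    have h4 : 2 * (orderOf D.σ : ℤ) ∣ 2 * (k : ℤ) := by
      have := dvd_sub h3 (dvd_sub hx hy)
      have e : ξ ((D.σ ^ k) x) - ξ x + 2 * (k : ℤ) - (t - ξ x - (t - ξ ((D.σ ^ k) x)))
        = 2 * k := by ring
      rwa [e] at this
    have h5 : (orderOf D.σ : ℤ) ∣ k := Int.dvd_of_mul_dvd_mul_left (by norm_num) h4
    have h6 : orderOf D.σ ∣ k := by exact_mod_cast h5
    rw [orderOf_dvd_iff_pow_eq_one.1 h6]; rfl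

/-- adjacency with smaller orbit first -/
lemma adj_small {C : CartanADE J} (D : DiagAut C) (ξ : J → ℤ) (hξ : IsHeightFunction C D ξ)
    (x y : J) (hxy : C.a x y = -1) (h : orbitSize D.σ x < orbitSize D.σ y) :
    orbitSize D.σ x = 1 ∧ orbitSize D.σ y = orderOf D.σ ∧
    (∃ e : ℤ, ξ x - ξ y = 2 * e + 1) ∧ ξ x ≤ ξ y + 2 * (orbitSize D.σ y : ℤ) ∧ ξ y ≤ ξ x + 2 := by
  have h1 := (orbitSize_one _ _).2 (small_fixed D x y hxy h)
  obtain ⟨j0, ⟨h2, h3, h4⟩, -⟩ := hξ.2 x y hxy h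
  have h5 := desc_of_exists D.σ ξ y j0 h2 h4
  obtain ⟨k, hk⟩ := h2.sym
  have h6 := h4 (k % orderOf D.σ) (Nat.mod_lt _ (orderOf_pos _))
  have hlt := Nat.mod_lt k (orderOf_pos D.σ)
  rw [pow_mod_orderOf, hk] at h6
  generalize k % orderOf D.σ = l at *
  rw [h5.1]
  refine ⟨h1, rfl, ?_⟩
  rcases (abs_eq (by norm_num)).1 h3 with h3 | h3
  · exact ⟨⟨l, by omega⟩, by omega, by omega⟩
  · exact ⟨⟨l - 1, by omega⟩, by omega, by omega⟩

lemma hcl_of {C : CartanADE J} (D : DiagAut C) (ξ : J → ℤ) (hξ : IsHeightFunction C D ξ) :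
    ∀ x y, C.a x y = -1 → ∀ t, Cls (fun z => (orbitSize D.σ z : ℤ)) ξ t x →
      ¬ Cls (fun z => (orbitSize D.σ z : ℤ)) ξ t y := by
  intro x y hxy t hx hy
  have par : ∀ z, Cls (fun z => (orbitSize D.σ z : ℤ)) ξ t z → ∃ e, t - ξ z = 2 * e := by
    rintro z ⟨e, he⟩
    exact ⟨orbitSize D.σ z * e, by rw [he]; ring⟩
  rcases lt_trichotomy (orbitSize D.σ x) (orbitSize D.σ y) with h | h | h
  · obtain ⟨-, -, ⟨e, he⟩, -⟩ := adj_small D ξ hξ x y hxy h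
    obtain ⟨e1, h1⟩ := par x hx
    obtain ⟨e2, h2⟩ := par y hy
    omega
  · have h1 := hξ.1 x y hxy h
    unfold Cls at hx hy
    simp only [← h] at hx hy
    have hd := dvd_sub hy hx
    have hpos := orbitSize_pos D.σ x
    have e : t - ξ y - (t - ξ x) = ξ x - ξ y := by ring
    rw [e] at hd
    have h2 := (dvd_abs _ _).2 hd
    rw [h1] at h2
    have := Int.le_of_dvd (by omega) h2
    omega
  · obtain ⟨-, -, ⟨e, he⟩, -⟩ := adj_small D ξ hξ y x (by rw [C.symm]; exact hxy) h
    obtain ⟨e1, h1⟩ := par x hx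
    obtain ⟨e2, h2⟩ := par y hy
    omega

lemma hup_of {C : CartanADE J} (D : DiagAut C) (ξ : J → ℤ) (hξ : IsHeightFunction C D ξ) :
    ∀ x y, C.a x y = -1 → ξ x ≤ ξ y + 2 * (orbitSize D.σ y : ℤ) := by
  intro x y hxy
  rcases lt_trichotomy (orbitSize D.σ x) (orbitSize D.σ y) with h | h | h
  · exact (adj_small D ξ hξ x y hxy h).2.2.2.1
  · have h1 := hξ.1 x y hxy h
    have := le_abs_self (ξ x - ξ y)
    omega
  · have := adj_small D ξ hξ y x (by rw [C.symm]; exact hxy) h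
    rw [this.1]
    have := this.2.2.2.2
    push_cast
    omega

lemma exists_star {C : CartanADE J} (D : DiagAut C) (ξ : J → ℤ) (hξ : IsHeightFunction C D ξ)
    (ι : J) (t : ℤ) (h : (2 : ℤ) ∣ t - ξ ι) :
    ∃ κ, SameOrbit D.σ ι κ ∧ Cls (fun z => (orbitSize D.σ z : ℤ)) ξ t κ := by
  rcases dichotomy D ξ hξ ι with h1 | ⟨h1, h2⟩
  · refine ⟨ι, SameOrbit.rfl', ?_⟩
    unfold Cls
    simp only [(orbitSize_one _ _).2 h1]
    simpa using h
  · obtain ⟨e, he⟩ := h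
    have hpos : (0 : ℤ) < orderOf D.σ := by exact_mod_cast orderOf_pos D.σ
    obtain ⟨k, hk⟩ : ∃ k : ℕ, (k : ℤ) = (-e) % (orderOf D.σ : ℤ) :=
      ⟨((-e) % (orderOf D.σ : ℤ)).toNat, Int.toNat_of_nonneg (Int.emod_nonneg _ hpos.ne')⟩
    refine ⟨(D.σ ^ k) ι, ⟨k, rfl⟩, ?_⟩
    unfold Cls
    simp only [orbitSize_pow, h1]
    obtain ⟨d, hd⟩ := h2 k
    have hdm := Int.emod_add_mul_ediv (-e) (orderOf D.σ : ℤ)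
    rw [← hk] at hdm
    refine ⟨- ((-e) / (orderOf D.σ : ℤ)) - d, ?_⟩
    linear_combination he - hd + 2 * hdm

/-! ### the ℓ-roots are killed -/

lemma telescope (x : ℤ → J → ℤ) (T : ℤ) (n : ℕ)
    (h : ∀ k : ℕ, x (T - 2 * k) = x (T - 1 - 2 * k)) :
    ∑ k ∈ Finset.range n, (x (T - 1 - 2 * k) - x (T - 1 - 2 * k - 1)) = x T - x (T - 2 * n) := by
  induction n with
  | zero => simp
  | succ n ih =>
    rw [Finset.sum_range_succ, ih, ← h n]
    have : T - 1 - 2 * (n : ℤ) - 1 = T - 2 * ((n + 1 : ℕ) : ℤ) := by push_cast; ring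
    rw [this]; abel

/-- contribution of the vertex `j` outside the orbit -/
lemma part_j {C : CartanADE J} (D : DiagAut C) (ξ : J → ℤ) (hξ : IsHeightFunction C D ξ)
    (c : J → J → ℤ) (hc : IsFoldedCartan C D.σ c)
    (X : ℤ → J → J → ℤ)
    (hX : ∀ t, X (t - 1) = stepP C (Cls (fun z => (orbitSize D.σ z : ℤ)) ξ t) (X t))
    (ι κ : J) (p : ℤ) (hικ : SameOrbit D.σ ι κ)
    (hκ : Cls (fun z => (orbitSize D.σ z : ℤ)) ξ (p + (orbitSize D.σ ι : ℤ)) κ)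
    (j : J) (hj : ¬ SameOrbit D.σ ι j) :
    ∑ k ∈ Finset.range (-(c j ι)).toNat,
      (X (p - c j ι - 1 - 2 * k) j - X (p - c j ι - 1 - 2 * k - 1) j)
    = if C.a κ j = -1 then X (p + (orbitSize D.σ ι : ℤ)) j - X (p - (orbitSize D.σ ι : ℤ)) j
      else 0 := by
  have hcj := hc j ι
  rw [if_neg (fun h => hj h.sym)] at hcj
  have hszκ := hικ.size
  by_cases hadj : adjOrbit C D.σ j ι
  · rw [if_pos hadj] at hcj
    obtain ⟨j', hjj', hκj'⟩ : ∃ j', SameOrbit D.σ j j' ∧ C.a κ j' = -1 := by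
      obtain ⟨j1, i1, hj1, hi1, h1⟩ := hadj
      obtain ⟨k, rfl⟩ := hi1.sym.tr hικ
      exact ⟨(D.σ ^ k) j1, hj1.tr ⟨k, rfl⟩, by rw [compat_pow, C.symm]; exact h1⟩
    have hszj := hjj'.size
    have hposι := orbitSize_pos D.σ ι
    have hposj := orbitSize_pos D.σ j
    rcases lt_trichotomy (orbitSize D.σ ι) (orbitSize D.σ j) with h | h | h
    · -- small vertex `ι`
      have hs := adj_small D ξ hξ κ j' hκj' (by omega)
      have hι1 : orbitSize D.σ ι = 1 := by omega
      have hκι : κ = ι := by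
        obtain ⟨k, rfl⟩ := hικ
        exact fixed_pow ((orbitSize_one _ _).1 hι1) k
      subst hκι
      have hcv : c j κ = -1 := by
        have : max (1 : ℚ) ((orbitSize D.σ κ : ℚ) / (orbitSize D.σ j : ℚ)) = 1 := by
          apply max_eq_left
          rw [hι1, div_le_one (by exact_mod_cast hposj)]
          exact_mod_cast hposj
        rw [this] at hcj
        exact_mod_cast hcj
      have hκj : C.a κ j = -1 := by
        obtain ⟨k, rfl⟩ := hjj'.sym
        rw [← compat_pow D k, fixed_pow ((orbitSize_one _ _).1 hι1) k] at hκj'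
        exact hκj'
      have hn : ¬ Cls (fun z => (orbitSize D.σ z : ℤ)) ξ (p + 1) j := by
        apply hcl_of D ξ hξ κ j hκj
        rw [hι1] at hκ; exact_mod_cast hκ
      have hst := dyn_stay C _ ξ X hX j (p + 1) hn
      rw [if_pos hκj, hcv, hι1]
      simp only [neg_neg, Int.toNat_one, Finset.range_one, Finset.sum_singleton]
      push_cast
      rw [show p - -1 - 1 - 0 = p by ring, ← hst, show p + 1 - 1 = p by ring]
    · -- equal sizes
      have hcv : c j ι = -1 := by
        have : (orbitSize D.σ ι : ℚ) / (orbitSize D.σ j : ℚ) = 1 := by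
          rw [h]; exact div_self (by positivity)
        rw [this, max_self] at hcj
        exact_mod_cast hcj
      have hj'cl : Cls (fun z => (orbitSize D.σ z : ℤ)) ξ p j' := by
        have h1 := hξ.1 κ j' hκj' (by omega)
        unfold Cls at hκ ⊢
        simp only [hszj, ← h, hszκ] at hκ h1 ⊢
        obtain ⟨d, hd⟩ := hκ
        rcases (abs_eq (by positivity)).1 h1 with h1 | h1
        · exact ⟨d, by linarith⟩
        · exact ⟨d - 1, by linarith⟩
      rw [hcv]
      simp only [neg_neg, Int.toNat_one, Finset.range_one, Finset.sum_singleton]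
      rw [show p - -1 - 1 - 2 * ((0 : ℕ) : ℤ) = p by push_cast; ring]
      by_cases hκj : C.a κ j = -1
      · rw [if_pos hκj]
        have hjcl : Cls (fun z => (orbitSize D.σ z : ℤ)) ξ p j := by
          have h1 := hξ.1 κ j hκj (by omega)
          unfold Cls at hκ ⊢
          simp only [← h, hszκ] at hκ h1 ⊢
          obtain ⟨d, hd⟩ := hκ
          rcases (abs_eq (by positivity)).1 h1 with h1 | h1
          · exact ⟨d, by linarith⟩
          · exact ⟨d - 1, by linarith⟩
        have e1 := dyn_const C _ ξ X hX j p hjcl (orbitSize D.σ ι) (by omega)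
        have hjcl2 : Cls (fun z => (orbitSize D.σ z : ℤ)) ξ
            (p - 2 * (orbitSize D.σ j : ℤ)) j := by
          unfold Cls at hjcl ⊢
          obtain ⟨d, hd⟩ := hjcl
          simp only [] at hd ⊢
          exact ⟨d - 1, by linarith⟩
        have e2 := dyn_const C _ ξ X hX j _ hjcl2 (orbitSize D.σ ι) (by omega)
        have e3 := dyn_const C _ ξ X hX j _ hjcl2 (2 * orbitSize D.σ ι - 1)
          (by omega)
        rw [e1]
        rw [show p - 2 * (orbitSize D.σ j : ℤ) + (orbitSize D.σ ι : ℤ)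
          = p - (orbitSize D.σ ι : ℤ) by omega] at e2
        rw [show p - 2 * (orbitSize D.σ j : ℤ) + ((2 * orbitSize D.σ ι - 1 : ℕ) : ℤ)
          = p - 1 by omega] at e3
        rw [e2, e3]
      · rw [if_neg hκj]
        have hn : ¬ Cls (fun z => (orbitSize D.σ z : ℤ)) ξ p j := by
          intro hcl
          have := distinct D ξ hξ j j' p hjj' hcl hj'cl
          subst this
          exact hκj hκj'
        rw [dyn_stay C _ ξ X hX j p hn, sub_self]
    · -- small vertex `j`
      have hs := adj_small D ξ hξ j' κ (by rw [C.symm]; exact hκj') (by omega)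
      have hj1 : orbitSize D.σ j = 1 := by omega
      have hjj : j' = j := by
        obtain ⟨k, rfl⟩ := hjj'
        exact fixed_pow ((orbitSize_one _ _).1 hj1) k
      subst hjj
      have hcv : c j' ι = -(orbitSize D.σ ι : ℤ) := by
        have : max (1 : ℚ) ((orbitSize D.σ ι : ℚ) / (orbitSize D.σ j' : ℚ))
            = orbitSize D.σ ι := by
          rw [hj1, Nat.cast_one, div_one]
          apply max_eq_right
          exact_mod_cast hposι
        rw [this] at hcj
        exact_mod_cast hcj
      rw [if_pos hκj', hcv, neg_neg, Int.toNat_natCast]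
      have := telescope (fun t => X t j') (p + (orbitSize D.σ ι : ℤ)) (orbitSize D.σ ι) (by
        intro k
        have hn : ¬ Cls (fun z => (orbitSize D.σ z : ℤ)) ξ
            (p + (orbitSize D.σ ι : ℤ) - 2 * k) j' := by
          have h0 := hcl_of D ξ hξ κ j' hκj' _ hκ
          intro hcl
          apply h0
          unfold Cls at hcl ⊢
          simp only [hj1] at hcl ⊢
          obtain ⟨d, hd⟩ := hcl
          exact ⟨d + k, by push_cast at hd ⊢; linarith⟩
        have := dyn_stay C _ ξ X hX j' _ hn
        rw [← this]
        congr 1; ring)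
      rw [show p + (orbitSize D.σ ι : ℤ) - 2 * (orbitSize D.σ ι : ℤ)
        = p - (orbitSize D.σ ι : ℤ) by ring] at this
      simp only [sub_neg_eq_add]
      exact this
  · rw [if_neg hadj] at hcj
    have hcv : c j ι = 0 := by exact_mod_cast hcj
    have hn : C.a κ j ≠ -1 := fun h =>
      hadj ⟨j, κ, SameOrbit.rfl', hικ, by rw [C.symm]; exact h⟩
    simp [hcv, hn]


/-! ### the linear functional on finitely supported functions -/

/-- `f` is finitely supported and its image under the linear extension of `B` is `v` -/
def Rep (B : J × ℤ → (J → ℤ)) (f : (J × ℤ) → ℤ) (v : J → ℤ) : Prop :=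
  ∃ g : (J × ℤ) →₀ ℤ, ⇑g = f ∧ Finsupp.linearCombination ℤ B g = v

lemma Rep.add {B : J × ℤ → (J → ℤ)} {f f' : (J × ℤ) → ℤ} {v v' : J → ℤ}
    (h : Rep B f v) (h' : Rep B f' v') : Rep B (f + f') (v + v') := by
  obtain ⟨g, rfl, rfl⟩ := h
  obtain ⟨g', rfl, rfl⟩ := h'
  exact ⟨g + g', by simp, by simp⟩

lemma Rep.sub {B : J × ℤ → (J → ℤ)} {f f' : (J × ℤ) → ℤ} {v v' : J → ℤ}
    (h : Rep B f v) (h' : Rep B f' v') : Rep B (f - f') (v - v') := by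
  obtain ⟨g, rfl, rfl⟩ := h
  obtain ⟨g', rfl, rfl⟩ := h'
  exact ⟨g - g', by simp, by simp⟩

lemma Rep.zero {B : J × ℤ → (J → ℤ)} : Rep B 0 0 := ⟨0, by simp, by simp⟩

lemma Rep.smul {B : J × ℤ → (J → ℤ)} {f : (J × ℤ) → ℤ} {v : J → ℤ}
    (h : Rep B f v) (a : ℤ) : Rep B (a • f) (a • v) := by
  obtain ⟨g, rfl, rfl⟩ := h
  exact ⟨a • g, by simp, by simp⟩

lemma Rep.sum {B : J × ℤ → (J → ℤ)} {α : Type} (S : Finset α) (f : α → (J × ℤ) → ℤ)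
    (v : α → J → ℤ) (h : ∀ x ∈ S, Rep B (f x) (v x)) :
    Rep B (∑ x ∈ S, f x) (∑ x ∈ S, v x) := by
  induction S using Finset.induction_on with
  | empty => simpa using Rep.zero
  | insert a S ha ih =>
    rw [Finset.sum_insert ha, Finset.sum_insert ha]
    exact (h a (by simp)).add (ih fun x hx => h x (by simp [hx]))

lemma Rep.unique {B : J × ℤ → (J → ℤ)} {f : (J × ℤ) → ℤ} {v v' : J → ℤ}
    (h : Rep B f v) (h' : Rep B f v') : v = v' := by
  obtain ⟨g, rfl, rfl⟩ := h
  obtain ⟨g', hg, rfl⟩ := h'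
  rw [DFunLike.coe_injective hg]

lemma Rep.single (B : J × ℤ → (J → ℤ)) (y : J × ℤ) :
    Rep B (fun z => if z = y then 1 else 0) (B y) := by
  refine ⟨Finsupp.single y 1, ?_, by simp⟩
  funext z
  rw [Finsupp.single_apply]
  simp only [eq_comm]

lemma rep_varpi (B : J × ℤ → (J → ℤ)) (σ : Equiv.Perm J) (ι : J) (p : ℤ) (κ : J)
    (hκ : SameOrbit σ ι κ) (h0 : ∀ j, SameOrbit σ ι j → j ≠ κ → B (j, p) = 0) :
    Rep B (varpiF σ ι p) (B (κ, p)) := by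
  have h := Rep.sum (B := B) (Finset.univ.filter fun j => SameOrbit σ ι j) _ _
    fun j _ => Rep.single B (j, p)
  have hsum : ∑ j ∈ Finset.univ.filter (fun j => SameOrbit σ ι j), B (j, p) = B (κ, p) := by
    apply Finset.sum_eq_single κ
    · intro j hj hne
      exact h0 j (by simpa using hj) hne
    · intro hn; exact absurd (by simp [hκ]) hn
  rw [hsum] at h
  convert h using 1
  funext y
  obtain ⟨y1, y2⟩ := y
  simp only [varpiF, Finset.sum_apply, Prod.mk.injEq]
  by_cases hy : SameOrbit σ ι y1 ∧ y2 = p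
  · rw [if_pos hy, Finset.sum_eq_single y1]
    · simp [hy.2]
    · intro b _ hb
      rw [if_neg (fun h => hb h.1.symm)]
    · intro hn; exact absurd (by simp [hy.1]) hn
  · rw [if_neg hy, Finset.sum_eq_zero]
    intro b hb
    rw [if_neg]
    rintro ⟨rfl, rfl⟩
    exact hy ⟨by simpa using hb, rfl⟩

lemma rep_third (B : J × ℤ → (J → ℤ)) (σ : Equiv.Perm J) (c : J → J → ℤ) (ι : J) (p : ℤ) :
    Rep B (fun y => if (¬ SameOrbit σ ι y.1) ∧
          ∃ k : ℤ, 1 ≤ k ∧ k ≤ -(c y.1 ι) ∧ y.2 = p - c y.1 ι + 1 - 2 * k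
       then 1 else 0)
      (∑ j ∈ Finset.univ.filter (fun j => ¬ SameOrbit σ ι j),
        ∑ k ∈ Finset.range (-(c j ι)).toNat, B (j, p - c j ι - 1 - 2 * (k : ℤ))) := by
  have h := Rep.sum (B := B) (Finset.univ.filter fun j => ¬ SameOrbit σ ι j) _ _
    fun j _ => Rep.sum (B := B) (Finset.range (-(c j ι)).toNat) _ _
      fun k _ => Rep.single B (j, p - c j ι - 1 - 2 * (k : ℤ))
  convert h using 1
  funext y
  obtain ⟨y1, y2⟩ := y
  simp only [Finset.sum_apply, Prod.mk.injEq]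
  by_cases hy : (¬ SameOrbit σ ι y1) ∧
          ∃ k : ℤ, 1 ≤ k ∧ k ≤ -(c y1 ι) ∧ y2 = p - c y1 ι + 1 - 2 * k
  · rw [if_pos hy, Finset.sum_eq_single y1]
    · obtain ⟨_, k, h1, h2, h3⟩ := hy
      rw [Finset.sum_eq_single (k - 1).toNat]
      · rw [if_pos]
        refine ⟨rfl, ?_⟩
        rw [Int.toNat_of_nonneg (by omega), h3]; ring
      · intro b _ hb
        rw [if_neg]
        rintro ⟨_, h4⟩
        apply hb
        omega
      · intro hn
        exfalso; apply hn
        rw [Finset.mem_range]; omega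
    · intro b _ hb
      apply Finset.sum_eq_zero
      intro k _
      rw [if_neg (fun h => hb h.1.symm)]
    · intro hn; exact absurd (by simp [hy.1]) hn
  · rw [if_neg hy, Finset.sum_eq_zero]
    intro b hb
    apply Finset.sum_eq_zero
    intro k hk
    rw [if_neg]
    rintro ⟨rfl, rfl⟩
    rw [Finset.mem_range] at hk
    refine hy ⟨by simpa using hb, (k : ℤ) + 1, by omega, by omega, by ring⟩

lemma rep_lroot {C : CartanADE J} (D : DiagAut C) (ξ : J → ℤ) (hξ : IsHeightFunction C D ξ)
    (c : J → J → ℤ) (hc : IsFoldedCartan C D.σ c)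
    (X : ℤ → J → J → ℤ)
    (hX : ∀ t, X (t - 1) = stepP C (Cls (fun z => (orbitSize D.σ z : ℤ)) ξ t) (X t))
    (ι : J) (p : ℤ) (hv : ValidLRootIdx D.σ ξ ι p) :
    Rep (fun y : J × ℤ => X y.2 y.1 - X (y.2 - 1) y.1) (lrootF D.σ c ι p) 0 := by
  obtain ⟨κ, hικ, hκ⟩ := exists_star D ξ hξ ι _ hv
  have hsz := hικ.size
  have hpos := orbitSize_pos D.σ ι
  have hκ2 : Cls (fun z => (orbitSize D.σ z : ℤ)) ξ (p - (orbitSize D.σ ι : ℤ)) κ := by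
    unfold Cls at hκ ⊢
    simp only [hsz] at hκ ⊢
    have := dvd_sub hκ (dvd_refl (2 * (orbitSize D.σ ι : ℤ)))
    rwa [show p + (orbitSize D.σ ι : ℤ) - ξ κ - 2 * (orbitSize D.σ ι : ℤ)
      = p - (orbitSize D.σ ι : ℤ) - ξ κ by ring] at this
  have hz : ∀ t, Cls (fun z => (orbitSize D.σ z : ℤ)) ξ t κ → ∀ j, SameOrbit D.σ ι j → j ≠ κ →
      (fun y : J × ℤ => X y.2 y.1 - X (y.2 - 1) y.1) (j, t) = 0 := by
    intro t ht j hj hne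
    simp only
    rw [dyn_stay C _ ξ X hX j t, sub_self]
    intro hcl
    exact hne (distinct D ξ hξ j κ t (hj.sym.tr hικ) hcl ht)
  have r1 := rep_varpi (fun y : J × ℤ => X y.2 y.1 - X (y.2 - 1) y.1) D.σ ι _ κ hικ (hz _ hκ)
  have r2 := rep_varpi (fun y : J × ℤ => X y.2 y.1 - X (y.2 - 1) y.1) D.σ ι _ κ hικ (hz _ hκ2)
  have r3 := rep_third (fun y : J × ℤ => X y.2 y.1 - X (y.2 - 1) y.1) D.σ c ι p
  have r := (r1.add r2).sub r3
  refine (congrArg (Rep _ _) ?_).mpr r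
  simp only
  have e3 : (∑ j ∈ Finset.univ.filter (fun j => ¬ SameOrbit D.σ ι j),
        ∑ k ∈ Finset.range (-(c j ι)).toNat, (X (p - c j ι - 1 - 2 * (k : ℤ)) j
          - X (p - c j ι - 1 - 2 * (k : ℤ) - 1) j))
      = ∑ j, (if C.a κ j = -1 then X (p + (orbitSize D.σ ι : ℤ)) j
          - X (p - (orbitSize D.σ ι : ℤ)) j else 0) := by
    rw [Finset.sum_filter]
    apply Finset.sum_congr rfl
    intro j _
    by_cases hj : SameOrbit D.σ ι j
    · rw [if_neg (by simpa using hj), if_neg]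
      intro hadj
      obtain ⟨k, rfl⟩ := hικ.sym.tr hj
      by_cases hk : (D.σ ^ k) κ = κ
      · rw [hk, C.diag] at hadj; omega
      · exact D.noAdj κ k hk hadj
    · rw [if_pos hj]
      exact part_j D ξ hξ c hc X hX ι κ p hικ hκ j hj
  rw [e3]
  have a1 := congrFun (hX (p + (orbitSize D.σ ι : ℤ))) κ
  have a2 := congrFun (hX (p - (orbitSize D.σ ι : ℤ))) κ
  have a3 := dyn_const C _ ξ X hX κ _ hκ2 (2 * orbitSize D.σ ι - 1) (by rw [hsz]; omega)
  rw [show p - (orbitSize D.σ ι : ℤ) + ((2 * orbitSize D.σ ι - 1 : ℕ) : ℤ)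
    = p + (orbitSize D.σ ι : ℤ) - 1 by omega] at a3
  rw [stepP, if_pos hκ] at a1
  rw [stepP, if_pos hκ2] at a2
  have e4 : ∑ j, (if C.a κ j = -1 then X (p + (orbitSize D.σ ι : ℤ)) j
          - X (p - (orbitSize D.σ ι : ℤ)) j else 0)
      = ∑ j, (if C.a κ j = -1 then X (p + (orbitSize D.σ ι : ℤ)) j else 0)
        - ∑ j, (if C.a κ j = -1 then X (p - (orbitSize D.σ ι : ℤ)) j else 0) := by
    rw [← Finset.sum_sub_distrib]
    apply Finset.sum_congr rfl
    intro j _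
    split_ifs <;> simp
  rw [e4]
  have b1 := sub_eq_zero.mpr a1
  have b2 := sub_eq_zero.mpr a2
  have b3 := sub_eq_zero.mpr a3
  funext x
  have d1 := congrFun a1 x
  have d2 := congrFun a2 x
  have d3 := congrFun a3 x
  simp only [Pi.add_apply, Pi.sub_apply, Pi.neg_apply, Pi.zero_apply] at d1 d2 d3 ⊢
  linarith

lemma rep_Omega {C : CartanADE J} (D : DiagAut C) (ξ : J → ℤ) (hξ : IsHeightFunction C D ξ)
    (X : ℤ → J → J → ℤ)
    (hX : ∀ t, X (t - 1) = stepP C (Cls (fun z => (orbitSize D.σ z : ℤ)) ξ t) (X t))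
    (hX0 : ∀ ι, X (ξ ι) ι = fw ι)
    {L : ℕ} (ii : Fin L → J) (ha : IsAdapted C D ξ ii) (m : (J → ℤ) → ℤ) :
    Rep (fun y : J × ℤ => X y.2 y.1 - X (y.2 - 1) y.1) (OmegaQmap C D.σ ξ ii m)
      (toW C (∑ k, m (betaOf C ii k) • betaOf C ii k)) := by
  rw [map_sum]
  unfold OmegaQmap
  apply Rep.sum
  intro k _
  rw [map_smul]
  apply Rep.smul
  have hw := dyn_word C D.σ (fun z => (orbitSize D.σ z : ℤ)) ξ (fun _ => rfl)
    (fun x => by have := orbitSize_pos D.σ x; omega)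
    (hcl_of D ξ hξ) (hup_of D ξ hξ) X hX hX0 ((List.ofFn ii).take k.1) (by
      intro l hl
      have hl' : l < k.1 ∧ l < L := by
        have h2 := k.2
        have h3 : l < k.1 := by simpa using hl
        omega
      have := ha ⟨l, hl'.2⟩
      simp only [List.take_take, List.getElem_take, List.getElem_ofFn]
      rwa [min_eq_left hl'.1.le])
  obtain ⟨h1, _, _, h4⟩ := hw
  have h5 := h4 (ii k) (ha k)
  have h6 := rep_varpi (fun y : J × ℤ => X y.2 y.1 - X (y.2 - 1) y.1) D.σ (ii k)
    (heightAt D.σ ξ ii k) (ii k) SameOrbit.rfl' (by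
      intro j hj hne
      simp only
      rw [dyn_stay C _ ξ X hX j _, sub_self]
      intro hcl
      exact hne (distinct D ξ hξ j _ _ hj.sym hcl (h1 (ii k))))
  convert h6 using 1
  exact h5.symm


/-- cf. Lemma 6.9: if two nonnegative Kostant-type partitions have
ℓ-weights differing by an element of the ℓ-root lattice `𝒬_ℤ`, then they are partitions
of the same element of the root lattice. -/
theorem statement15 (C : CartanADE J) (D : DiagAut C) (ξ : J → ℤ)
    (hξ : IsHeightFunction C D ξ)
    (c : J → J → ℤ) (hc : IsFoldedCartan C D.σ c)
    (L : ℕ) (ii : Fin L → J) (hr : IsReducedWord C ii) (ha : IsAdapted C D ξ ii)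
    (m n : (J → ℤ) → ℤ)
    (hm0 : ∀ v : J → ℤ, v ∉ posRoots C → m v = 0)
    (hm1 : ∀ v ∈ posRoots C, 0 ≤ m v)
    (hn0 : ∀ v : J → ℤ, v ∉ posRoots C → n v = 0)
    (hn1 : ∀ v ∈ posRoots C, 0 ≤ n v)
    (h : OmegaQmap C D.σ ξ ii m - OmegaQmap C D.σ ξ ii n ∈
      AddSubgroup.closure (lrootSet D.σ ξ c)) :
    ∑ᶠ v ∈ posRoots C, m v • v = ∑ᶠ v ∈ posRoots C, n v • v := by
  rw [sum_posRoots C ii hr, sum_posRoots C ii hr]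
  obtain ⟨X, hX, hX0⟩ := exists_dyn C (fun z => (orbitSize D.σ z : ℤ)) ξ
    (fun x => by have := orbitSize_pos D.σ x; omega)
    (hcl_of D ξ hξ) (hup_of D ξ hξ) fw
  have key : Rep (fun y : J × ℤ => X y.2 y.1 - X (y.2 - 1) y.1)
      (OmegaQmap C D.σ ξ ii m - OmegaQmap C D.σ ξ ii n) 0 := by
    refine AddSubgroup.closure_induction
      (p := fun f _ => Rep (fun y : J × ℤ => X y.2 y.1 - X (y.2 - 1) y.1) f 0) ?_ ?_ ?_ ?_ h
    · rintro f ⟨ι, p, hv, rfl⟩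
      exact rep_lroot D ξ hξ c hc X hX ι p hv
    · exact Rep.zero
    · intro x y _ _ hx hy
      simpa using hx.add hy
    · intro x _ hx
      simpa using Rep.zero.sub hx
  have k2 := (rep_Omega D ξ hξ X hX hX0 ii ha m).sub (rep_Omega D ξ hξ X hX hX0 ii ha n)
  have k3 := k2.unique key
  rw [← map_sub] at k3
  exact sub_eq_zero.mp (toW_inj C _ k3)

end QDatumPaper
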